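/- arXiv:1512.01638 — 2 statements merged into one kernel-verified Lean document; each statement's English description precedes it below -/
import Mathlib

section
/- Let γ ∈ (−3,−2), let k > (γ+3)/2 and set m(v) = ⟨v⟩^k. Let χ : ℝ³ → [0,1] be a smooth function with χ(v) = 1 for |v| ≤ 1 and χ(v) = 0 for |v| > 2, and set χ_R(v) = χ(v/R). Then there exist constants M, R, C > 0 such that for every Schwartz function f on ℝ³, with Bf := Σ_{i,j} ā_{ij} ∂_{ij}f − c̄ f − M χ_R f, one has ∫_{ℝ³} (Bf)(v) f(v) m(v)² dv ≤ −C ( ∫_{ℝ³} ⟨v⟩^γ |∇̃f(v)|² m(v)² dv + ∫_{ℝ³} ⟨v⟩^γ |∇̃(mf)(v)|² dv + ∫_{ℝ³} ⟨v⟩^γ f(v)² m(v)² dv ). -/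
noncomputable section

open MeasureTheory Real Filter

abbrev V3 := EuclideanSpace ℝ (Fin 3)

/-- Japanese bracket ⟨v⟩ = (1+|v|²)^{1/2}. -/
def jap (v : V3) : ℝ := Real.sqrt (1 + ‖v‖ ^ 2)

/-- Standard Gaussian μ on ℝ³. -/
def gaussM (v : V3) : ℝ := (2 * Real.pi) ^ (-(3 : ℝ) / 2) * Real.exp (-‖v‖ ^ 2 / 2)

/-- Landau kernel matrix a_{ij}(z). -/
def aker (γ : ℝ) (z : V3) (i j : Fin 3) : ℝ :=
  ‖z‖ ^ (γ + 2) * ((if i = j then (1 : ℝ) else 0) - z i * z j / ‖z‖ ^ 2)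

/-- ā_{ij} = a_{ij} * μ. -/
def abar (γ : ℝ) (v : V3) (i j : Fin 3) : ℝ := ∫ w : V3, aker γ (v - w) i j * gaussM w

def bker (γ : ℝ) (z : V3) (i : Fin 3) : ℝ := -2 * ‖z‖ ^ γ * z i

/-- b̄_i = b_i * μ. -/
def bbar (γ : ℝ) (v : V3) (i : Fin 3) : ℝ := ∫ w : V3, bker γ (v - w) i * gaussM w

/-- J_β(v) = ∫ |v−w|^β μ(w) dw. -/
def Jfun (β : ℝ) (v : V3) : ℝ := ∫ w : V3, ‖v - w‖ ^ β * gaussM w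

/-- c̄(v) = −2(γ+3) J_γ(v). -/
def cbar (γ : ℝ) (v : V3) : ℝ := -2 * (γ + 3) * Jfun γ v

/-- ℓ₁(v). -/
def ell1 (γ : ℝ) (v : V3) : ℝ :=
  ∫ w : V3, (1 - ((∑ i, v i * w i) / (‖v‖ * ‖w‖)) ^ 2) * ‖w‖ ^ (γ + 2) * gaussM (v - w)

/-- Squared Euclidean norm of the cross product of two vectors in ℝ³. -/
def crossSq (a b : V3) : ℝ :=
  ∑ i, (crossProduct (R := ℝ) (fun k => a k) (fun k => b k) i) ^ 2

/-- ℓ₂(v). -/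
def ell2 (γ : ℝ) (v : V3) : ℝ :=
  ∫ w : V3,
    (1 - (1 / 2) * crossSq (‖v‖⁻¹ • v) (‖w‖⁻¹ • w)) * ‖w‖ ^ (γ + 2) * gaussM (v - w)

/-- Projection P_v ξ on the direction v. -/
def Pv (v ξ : V3) : V3 := ((∑ i, ξ i * v i) / ‖v‖ ^ 2) • v

/-- Partial derivative in the i-th coordinate direction. -/
def pd (i : Fin 3) (f : V3 → ℝ) : V3 → ℝ := fun v => fderiv ℝ f v (EuclideanSpace.single i 1)

/-- Anisotropic gradient ∇̃f = P_v ∇f + ⟨v⟩ (I − P_v) ∇f. -/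
def anisoGrad (f : V3 → ℝ) (v : V3) : V3 :=
  Pv v (gradient f v) + jap v • (gradient f v - Pv v (gradient f v))

/-- The filter |v| → ∞ on ℝ³. -/
def normAtTop : Filter V3 := Filter.comap (fun v : V3 => ‖v‖) Filter.atTop

/-- ζ_m(v) = Σ ā_{ij} ∂_{ij}m/m + Σ ā_{ij} (∂_i m/m)(∂_j m/m) + 2 Σ b̄_i ∂_i m/m − c̄/2. -/
def zeta (γ : ℝ) (m : V3 → ℝ) (v : V3) : ℝ :=
  (∑ i, ∑ j, abar γ v i j * pd i (pd j m) v / m v)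
  + (∑ i, ∑ j, abar γ v i j * (pd i m v / m v) * (pd j m v / m v))
  + 2 * (∑ i, bbar γ v i * pd i m v / m v)
  - cbar γ v / 2

/-- ζ̃_m(v) = Σ ā_{ij} (∂_i m/m)(∂_j m/m) + Σ b̄_i ∂_i m/m − c̄/2. -/
def zetaT (γ : ℝ) (m : V3 → ℝ) (v : V3) : ℝ :=
  (∑ i, ∑ j, abar γ v i j * (pd i m v / m v) * (pd j m v / m v))
  + (∑ i, bbar γ v i * pd i m v / m v)
  - cbar γ v / 2

/-- ζ_{m,ω}(v). -/
def zetaMW (γ : ℝ) (m ω : V3 → ℝ) (v : V3) : ℝ :=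
  (∑ i, ∑ j, abar γ v i j * pd i (pd j ω) v / ω v)
  + (∑ i, ∑ j, abar γ v i j * (pd i ω v / ω v) * (pd j ω v / ω v))
  - 2 * (∑ i, ∑ j, abar γ v i j * (pd i ω v / ω v) * (pd j m v / m v))

/-- B₀f = Σ ā_{ij} ∂_{ij}f − c̄ f. -/
def B0op (γ : ℝ) (f : V3 → ℝ) (v : V3) : ℝ :=
  (∑ i, ∑ j, abar γ v i j * pd i (pd j f) v) - cbar γ v * f v


/-- The singular part `|z|^γ` of the kernels, cut off to the unit ball. -/
def singPart (γ : ℝ) : V3 → ℝ := (Metric.ball (0 : V3) 1).indicator (fun z => ‖z‖ ^ γ)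

/-- A common majorant for all the kernels `a`, `b`, `c`. -/
def majK (γ : ℝ) (z : V3) : ℝ := singPart γ z + 1

/-- An integrable bounded profile dominating Gaussians and Schwartz functions. -/
def decD (w : V3) : ℝ := (1 + ‖w‖ ^ 2) ^ (-2 : ℝ)

/-- Measurable kernels dominated by a multiple of `majK` away from the origin. -/
def KerBdd (γ : ℝ) (k : V3 → ℝ) : Prop :=
  Measurable k ∧ ∃ C, 0 ≤ C ∧ ∀ z, z ≠ 0 → |k z| ≤ C * majK γ z

/-- Measurable functions dominated by a multiple of `decD`. -/
def Dec (g : V3 → ℝ) : Prop := Measurable g ∧ ∃ C, 0 ≤ C ∧ ∀ w, |g w| ≤ C * decD w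

lemma singPart_nonneg (γ : ℝ) (z : V3) : 0 ≤ singPart γ z :=
  Set.indicator_nonneg (fun _ _ => by positivity) _

lemma measurable_singPart (γ : ℝ) : Measurable (singPart γ) :=
  Measurable.indicator (by fun_prop) Metric.isOpen_ball.measurableSet

lemma integrable_singPart {γ : ℝ} (hγ : -3 < γ) : Integrable (singPart γ) := by
  rw [singPart, integrable_indicator_iff Metric.isOpen_ball.measurableSet]
  refine integrableOn_ball_of_norm_le_rpow (C := 1) (α := -γ) (by simp) (by simp; linarith) ?_
    (by fun_prop : Measurable fun z : V3 => ‖z‖ ^ γ).aestronglyMeasurable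
  refine Eventually.of_forall fun x => ?_
  rw [Real.norm_of_nonneg (by positivity)]
  simp

lemma singPart_neg (γ : ℝ) (z : V3) : singPart γ (-z) = singPart γ z := by
  simp [singPart, Set.indicator]

lemma majK_neg (γ : ℝ) (z : V3) : majK γ (-z) = majK γ z := by
  simp [majK, singPart_neg]

lemma one_le_majK (γ : ℝ) (z : V3) : 1 ≤ majK γ z := by
  have := singPart_nonneg γ z
  unfold majK; linarith

lemma majK_nonneg (γ : ℝ) (z : V3) : 0 ≤ majK γ z := by
  linarith [one_le_majK γ z]

lemma measurable_majK (γ : ℝ) : Measurable (majK γ) :=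
  (measurable_singPart γ).add_const 1

lemma rpow_norm_le_majK {γ β : ℝ} (h1 : γ ≤ β) (h2 : β ≤ 0) {z : V3} (hz : z ≠ 0) :
    ‖z‖ ^ β ≤ majK γ z := by
  have hz' : 0 < ‖z‖ := norm_pos_iff.2 hz
  by_cases h : ‖z‖ < 1
  · have : singPart γ z = ‖z‖ ^ γ := by simp [singPart, h]
    have h3 : ‖z‖ ^ β ≤ ‖z‖ ^ γ := Real.rpow_le_rpow_of_exponent_ge hz' h.le h1
    unfold majK; linarith
  · exact (Real.rpow_le_one_of_one_le_of_nonpos (not_lt.1 h) h2).trans (one_le_majK γ z)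

lemma decD_pos (w : V3) : 0 < decD w := by unfold decD; positivity

lemma decD_le_one (w : V3) : decD w ≤ 1 :=
  Real.rpow_le_one_of_one_le_of_nonpos (by nlinarith [sq_nonneg ‖w‖]) (by norm_num)

lemma measurable_decD : Measurable decD := by unfold decD; fun_prop

lemma integrable_decD : Integrable decD := by
  have := integrable_rpow_neg_one_add_norm_sq (E := V3) (μ := volume) (r := 4) (by simp; norm_num)
  unfold decD; convert! this using 3; norm_num

lemma ae_sub_ne_zero (v : V3) : ∀ᵐ w : V3, v - w ≠ 0 := by
  have : ∀ᵐ w : V3, w ≠ v := by simp [ae_iff]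
  filter_upwards [this] with w hw h
  exact hw (sub_eq_zero.1 h).symm

lemma ae_sub_ne_zero' (v : V3) : ∀ᵐ w : V3, w - v ≠ 0 := by
  filter_upwards [ae_sub_ne_zero v] with w hw h
  exact hw (by rw [← neg_sub, h, neg_zero])

lemma Dec.integrable {g : V3 → ℝ} (hg : Dec g) : Integrable g := by
  obtain ⟨hm, C, -, hC⟩ := hg
  exact (integrable_decD.const_mul C).mono' hm.aestronglyMeasurable
    (Eventually.of_forall fun w => by simpa using hC w)

lemma integrable_majK_mul_decD {γ : ℝ} (hγ : -3 < γ) (x : V3) :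
    Integrable (fun y => majK γ (x - y) * decD y) := by
  have h1 : Integrable (fun y => singPart γ (x - y) + decD y) :=
    ((integrable_singPart hγ).comp_sub_left x).add integrable_decD
  refine h1.mono' (((measurable_majK γ).comp (by fun_prop)).mul measurable_decD).aestronglyMeasurable
    (Eventually.of_forall fun y => ?_)
  rw [Real.norm_of_nonneg (mul_nonneg (majK_nonneg _ _) (decD_pos _).le)]
  unfold majK
  nlinarith [singPart_nonneg γ (x - y), decD_pos y, decD_le_one y]

lemma exists_integral_majK_mul_decD_le {γ : ℝ} (hγ : -3 < γ) :
    ∃ C, 0 ≤ C ∧ ∀ x, ∫ y, majK γ (x - y) * decD y ≤ C := by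
  refine ⟨(∫ y, singPart γ y) + ∫ y, decD y, ?_, fun x => ?_⟩
  · exact add_nonneg (integral_nonneg fun y => singPart_nonneg γ y)
      (integral_nonneg fun y => (decD_pos y).le)
  · rw [← integral_sub_left_eq_self (singPart γ) volume x,
      ← integral_add ((integrable_singPart hγ).comp_sub_left x) integrable_decD]
    refine integral_mono (integrable_majK_mul_decD hγ x)
      (((integrable_singPart hγ).comp_sub_left x).add integrable_decD) fun y => ?_
    simp only [majK]
    nlinarith [singPart_nonneg γ (x - y), decD_pos y, decD_le_one y]

lemma KerBdd.neg {γ : ℝ} {k : V3 → ℝ} (hk : KerBdd γ k) : KerBdd γ (fun z => k (-z)) := by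
  obtain ⟨hm, C, hC0, hC⟩ := hk
  exact ⟨hm.comp measurable_neg, C, hC0, fun z hz => by
    simpa [majK_neg] using hC (-z) (by simpa using hz)⟩

/-- Integrability of `w ↦ k (v - w) g w`. -/
lemma KerBdd.integrable_mul {γ : ℝ} (hγ : -3 < γ) {k g : V3 → ℝ} (hk : KerBdd γ k) (hg : Dec g)
    (v : V3) : Integrable (fun w => k (v - w) * g w) := by
  obtain ⟨hm, C, hC0, hC⟩ := hk
  obtain ⟨hgm, D, hD0, hD⟩ := hg
  refine ((integrable_majK_mul_decD hγ v).const_mul (C * D)).mono'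
    ((hm.comp (by fun_prop)).mul hgm).aestronglyMeasurable ?_
  filter_upwards [ae_sub_ne_zero v] with w hw
  rw [Real.norm_eq_abs, abs_mul]
  calc |k (v - w)| * |g w| ≤ (C * majK γ (v - w)) * (D * decD w) :=
        mul_le_mul (hC _ hw) (hD w) (abs_nonneg _) (mul_nonneg hC0 (majK_nonneg _ _))
    _ = _ := by ring

lemma KerBdd.integrable_mul' {γ : ℝ} (hγ : -3 < γ) {k g : V3 → ℝ} (hk : KerBdd γ k) (hg : Dec g)
    (w : V3) : Integrable (fun v => k (v - w) * g v) := by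
  simpa using hk.neg.integrable_mul hγ hg w

/-- Integrability of `(v, w) ↦ k (v - w) g w F v` on the product space. -/
lemma KerBdd.integrable_prod {γ : ℝ} (hγ : -3 < γ) {k g F : V3 → ℝ} (hk : KerBdd γ k)
    (hg : Dec g) (hF : Dec F) :
    Integrable (fun p : V3 × V3 => k (p.1 - p.2) * g p.2 * F p.1) (volume.prod volume) := by
  obtain ⟨hm, C, hC0, hC⟩ := hk
  obtain ⟨hgm, D, hD0, hD⟩ := hg
  obtain ⟨hFm, D', hD'0, hD'⟩ := hF
  have h1 : Integrable (fun p : V3 × V3 => decD p.2 * singPart γ (p.1 - p.2))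
      (volume.prod volume) :=
    integrable_decD.convolution_integrand (ContinuousLinearMap.mul ℝ ℝ) (integrable_singPart hγ)
  have h2 : Integrable (fun p : V3 × V3 => decD p.1 * decD p.2) (volume.prod volume) :=
    integrable_decD.mul_prod integrable_decD
  refine ((h1.add h2).const_mul (C * D * D')).mono' ?_ ?_
  · exact (((hm.comp (by fun_prop)).mul (hgm.comp measurable_snd)).mul
      (hFm.comp measurable_fst)).aestronglyMeasurable
  · have hne : ∀ᵐ p : V3 × V3 ∂(volume.prod volume), p.1 - p.2 ≠ 0 := by
      refine (Measure.ae_prod_iff_ae_ae ?_).2 (Eventually.of_forall fun v => ae_sub_ne_zero v)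
      exact (measurableSet_singleton (0 : V3)).compl.preimage
        (by fun_prop : Measurable fun p : V3 × V3 => p.1 - p.2)
    filter_upwards [hne] with p hp
    rw [Real.norm_eq_abs, abs_mul, abs_mul]
    have e1 := singPart_nonneg γ (p.1 - p.2)
    have e2 := decD_pos p.1
    have e3 := decD_pos p.2
    have e4 := decD_le_one p.1
    calc |k (p.1 - p.2)| * |g p.2| * |F p.1|
        ≤ (C * majK γ (p.1 - p.2)) * (D * decD p.2) * (D' * decD p.1) :=
          mul_le_mul (mul_le_mul (hC _ hp) (hD _) (abs_nonneg _)
            (mul_nonneg hC0 (majK_nonneg _ _))) (hD' _) (abs_nonneg _)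
            (mul_nonneg (mul_nonneg hC0 (majK_nonneg _ _)) (mul_nonneg hD0 e3.le))
      _ = C * D * D' * (decD p.2 * singPart γ (p.1 - p.2) * decD p.1 + decD p.1 * decD p.2) := by
          unfold majK; ring
      _ ≤ C * D * D' * (decD p.2 * singPart γ (p.1 - p.2) + decD p.1 * decD p.2) := by
          refine mul_le_mul_of_nonneg_left ?_ (by positivity)
          have := mul_le_of_le_one_right (mul_nonneg e3.le e1) e4
          linarith

/-- Convolution of a kernel against the Gaussian. -/
def gconv (k : V3 → ℝ) (v : V3) : ℝ := ∫ w, k (v - w) * gaussM w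

lemma gaussM_nonneg (w : V3) : 0 ≤ gaussM w := by unfold gaussM; positivity

lemma gaussM_pos (w : V3) : 0 < gaussM w := by unfold gaussM; positivity

lemma measurable_gaussM : Measurable gaussM := by unfold gaussM; fun_prop

lemma exists_gaussM_le : ∃ C, 0 ≤ C ∧ ∀ w, gaussM w ≤ C * (1 + ‖w‖ ^ 2) ^ (-5 : ℝ) := by
  refine ⟨(2 * π) ^ (-(3 : ℝ) / 2) * (3840 * exp (1 / 2)), by positivity, fun w => ?_⟩
  unfold gaussM
  rw [mul_assoc]
  gcongr
  set s := 1 + ‖w‖ ^ 2 with hs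
  have hs0 : 0 < s := by positivity
  have h := Real.pow_div_factorial_le_exp (s / 2) (by positivity) 5
  have h3 : s ^ 5 ≤ 3840 * exp (s / 2) := by
    have : ((5 : ℕ).factorial : ℝ) = 120 := by norm_num [Nat.factorial]
    rw [this, div_le_iff₀ (by norm_num)] at h
    nlinarith
  have h4 : -‖w‖ ^ 2 / 2 = 1 / 2 + -(s / 2) := by rw [hs]; ring
  have h5 : s ^ (-5 : ℝ) = (s ^ 5)⁻¹ := by
    rw [Real.rpow_neg hs0.le]; norm_cast
  rw [h4, Real.exp_add, Real.exp_neg, h5, mul_comm 3840, mul_assoc]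
  gcongr
  rw [← div_eq_mul_inv, le_div_iff₀ (by positivity), inv_mul_le_iff₀ (by positivity)]
  linarith

/-- A polynomial weight against the Gaussian is dominated by `decD`. -/
lemma dec_rpow_mul_gaussM {p : ℝ} (hp : p ≤ 3) :
    Dec (fun w => (1 + ‖w‖ ^ 2) ^ p * gaussM w) := by
  obtain ⟨C, hC0, hC⟩ := exists_gaussM_le
  refine ⟨by have := measurable_gaussM; fun_prop, C, hC0, fun w => ?_⟩
  have h1 : (1 : ℝ) ≤ 1 + ‖w‖ ^ 2 := by nlinarith [sq_nonneg ‖w‖]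
  rw [abs_of_nonneg (mul_nonneg (by positivity) (gaussM_nonneg w))]
  calc (1 + ‖w‖ ^ 2) ^ p * gaussM w
      ≤ (1 + ‖w‖ ^ 2) ^ (3 : ℝ) * (C * (1 + ‖w‖ ^ 2) ^ (-5 : ℝ)) := by
        gcongr
        · exact gaussM_nonneg w
        · exact hC w
    _ = C * ((1 + ‖w‖ ^ 2) ^ (3 : ℝ) * (1 + ‖w‖ ^ 2) ^ (-5 : ℝ)) := by ring
    _ = C * decD w := by
        rw [← Real.rpow_add (by positivity)]; norm_num [decD]

lemma dec_gaussM : Dec gaussM := by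
  simpa using dec_rpow_mul_gaussM (p := 0) (by norm_num)

lemma KerBdd.integrable_gconv_mul {γ : ℝ} (hγ : -3 < γ) {k F : V3 → ℝ} (hk : KerBdd γ k)
    (hF : Dec F) : Integrable (fun v => gconv k v * F v) := by
  have := (hk.integrable_prod hγ dec_gaussM hF).integral_prod_left
  simpa only [gconv, integral_mul_const] using this

lemma KerBdd.integral_gconv_mul {γ : ℝ} (hγ : -3 < γ) {k F : V3 → ℝ} (hk : KerBdd γ k)
    (hF : Dec F) :
    ∫ v, gconv k v * F v = ∫ w, (∫ v, k (v - w) * F v) * gaussM w := by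
  have := integral_integral_swap (f := fun v w => k (v - w) * gaussM w * F v)
    (hk.integrable_prod hγ dec_gaussM hF)
  simp only [gconv, ← integral_mul_const]
  rw [this]
  congr! 4 with w v
  ring

lemma KerBdd.integrable_integral_mul {γ : ℝ} (hγ : -3 < γ) {k F : V3 → ℝ} (hk : KerBdd γ k)
    (hF : Dec F) : Integrable (fun w => (∫ v, k (v - w) * F v) * gaussM w) := by
  have := (hk.integrable_prod hγ dec_gaussM hF).integral_prod_right
  simp only [← integral_mul_const]
  convert! this using 4 with w v
  ring

lemma kerBdd_norm_rpow {γ β : ℝ} (h1 : γ ≤ β) (h2 : β ≤ 0) : KerBdd γ (fun z => ‖z‖ ^ β) :=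
  ⟨by fun_prop, 1, zero_le_one, fun z hz => by
    rw [abs_of_nonneg (by positivity), one_mul]; exact rpow_norm_le_majK h1 h2 hz⟩

open LineDeriv

/-- The weight `(c + |z|²)^p`. -/
def wgt (c p : ℝ) (z : V3) : ℝ := (c + ‖z‖ ^ 2) ^ p

lemma wgt_pos {c : ℝ} (hc : 0 < c) (p : ℝ) (z : V3) : 0 < wgt c p z := by
  unfold wgt; positivity

lemma hasTemperateGrowth_wgt {c : ℝ} (hc : 0 < c) (p : ℝ) :
    Function.HasTemperateGrowth (wgt c p) := by
  have h : wgt c p = fun z => c ^ p * (1 + ‖(√c)⁻¹ • z‖ ^ 2) ^ p := by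
    funext z
    unfold wgt
    rw [← Real.mul_rpow hc.le (by positivity), norm_smul, mul_pow, norm_inv, inv_pow,
      Real.norm_of_nonneg (Real.sqrt_nonneg c), Real.sq_sqrt hc.le]
    congr 1
    field_simp
  rw [h]
  refine (Function.HasTemperateGrowth.const _).mul ?_
  exact (Function.hasTemperateGrowth_one_add_norm_sq_rpow (H := V3) p).comp
    (((√c)⁻¹ • ContinuousLinearMap.id ℝ V3).hasTemperateGrowth)

lemma hasTemperateGrowth_coord (i : Fin 3) : Function.HasTemperateGrowth (fun z : V3 => z i) :=
  (EuclideanSpace.proj (𝕜 := ℝ) i : V3 →L[ℝ] ℝ).hasTemperateGrowth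

lemma pd_coord (i j : Fin 3) (v : V3) : pd j (fun z => z i) v = if i = j then 1 else 0 := by
  have : (fun z : V3 => z i) = (EuclideanSpace.proj (𝕜 := ℝ) i : V3 →L[ℝ] ℝ) := rfl
  rw [pd, this, ContinuousLinearMap.fderiv]
  simp

lemma pd_mul {f g : V3 → ℝ} {v : V3} (j : Fin 3) (hf : DifferentiableAt ℝ f v)
    (hg : DifferentiableAt ℝ g v) :
    pd j (fun z => f z * g z) v = pd j f v * g v + f v * pd j g v := by
  simp only [pd]
  rw [fderiv_fun_mul hf hg]
  simp; ring

lemma pd_sub {f g : V3 → ℝ} {v : V3} (j : Fin 3) (hf : DifferentiableAt ℝ f v)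
    (hg : DifferentiableAt ℝ g v) :
    pd j (fun z => f z - g z) v = pd j f v - pd j g v := by
  simp only [pd]
  rw [fderiv_fun_sub hf hg]
  simp

lemma pd_const_mul {f : V3 → ℝ} {v : V3} (j : Fin 3) (c : ℝ) (hf : DifferentiableAt ℝ f v) :
    pd j (fun z => c * f z) v = c * pd j f v := by
  simp only [pd]
  rw [fderiv_const_mul hf]
  simp

lemma pd_comp_sub (f : V3 → ℝ) (w v : V3) (j : Fin 3) :
    pd j (fun z => f (z - w)) v = pd j f (v - w) := by
  simp only [pd]
  rw [fderiv_comp_sub]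

lemma differentiable_coord (i : Fin 3) : Differentiable ℝ (fun z : V3 => z i) :=
  (EuclideanSpace.proj (𝕜 := ℝ) i : V3 →L[ℝ] ℝ).differentiable

lemma pd_norm_sq (j : Fin 3) (v : V3) : pd j (fun z => ‖z‖ ^ 2) v = 2 * v j := by
  have h := (hasStrictFDerivAt_norm_sq v).hasFDerivAt.fderiv
  simp only [pd]
  rw [h]
  simp [EuclideanSpace.inner_single_right]

lemma differentiable_wgt {c : ℝ} (hc : 0 < c) (p : ℝ) : Differentiable ℝ (wgt c p) :=
  (hasTemperateGrowth_wgt hc p).1.differentiable (by simp)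

lemma pd_wgt {c : ℝ} (hc : 0 < c) (p : ℝ) (j : Fin 3) (v : V3) :
    pd j (wgt c p) v = 2 * p * v j * wgt c (p - 1) v := by
  have h1 : HasFDerivAt (fun z : V3 => c + ‖z‖ ^ 2) (fderiv ℝ (fun z : V3 => ‖z‖ ^ 2) v) v :=
    ((hasStrictFDerivAt_norm_sq v).hasFDerivAt.differentiableAt.hasFDerivAt).const_add c
  have h2 := h1.rpow_const (p := p) (Or.inl (by positivity))
  have h3 := h2.fderiv
  have h4 := pd_norm_sq j v
  simp only [pd] at h4 ⊢
  unfold wgt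
  rw [h3]
  simp only [smul_apply, smul_eq_mul]
  rw [h4]; ring

lemma SchwartzMap.dec (F : SchwartzMap V3 ℝ) : Dec F := by
  obtain ⟨C0, hC0, h0⟩ := F.decay 0 0
  obtain ⟨C4, hC4, h4⟩ := F.decay 4 0
  refine ⟨F.continuous.measurable, 2 * (C0 + C4), by positivity, fun w => ?_⟩
  have a0 := h0 w
  have a4 := h4 w
  simp only [norm_iteratedFDeriv_zero, pow_zero, one_mul, Real.norm_eq_abs] at a0 a4
  have : decD w = ((1 + ‖w‖ ^ 2) ^ 2)⁻¹ := by
    unfold decD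
    rw [Real.rpow_neg (by positivity)]; norm_cast
  rw [this, ← div_eq_mul_inv, le_div_iff₀ (by positivity)]
  nlinarith [abs_nonneg (F w), mul_nonneg (abs_nonneg (F w)) (sq_nonneg (1 - ‖w‖ ^ 2))]

lemma SchwartzMap.coe_pd (F : SchwartzMap V3 ℝ) (j : Fin 3) :
    pd j F = ⇑(∂_{(EuclideanSpace.single j (1 : ℝ) : V3)} F : SchwartzMap V3 ℝ) := rfl

lemma SchwartzMap.integral_pd (F : SchwartzMap V3 ℝ) (j : Fin 3) : ∫ v, pd j F v = 0 := by
  have h := integral_mul_fderiv_eq_neg_fderiv_mul_of_integrable (μ := (volume : Measure V3))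
    (f := fun _ : V3 => (1 : ℝ)) (g := F) (v := EuclideanSpace.single j 1) (by simp)
    (by
      simp only [one_mul]
      exact (∂_{(EuclideanSpace.single j (1 : ℝ) : V3)} F : SchwartzMap V3 ℝ).integrable)
    (by simpa using F.integrable) (fun _ _ => by fun_prop) (fun _ _ => F.differentiableAt)
  simpa [pd] using h

lemma Function.HasTemperateGrowth.comp_sub {g : V3 → ℝ} (hg : g.HasTemperateGrowth) (w : V3) :
    Function.HasTemperateGrowth (fun v => g (v - w)) :=
  hg.comp (Function.HasTemperateGrowth.id'.sub (Function.HasTemperateGrowth.const w))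

lemma Function.HasTemperateGrowth.differentiable {g : V3 → ℝ} (hg : g.HasTemperateGrowth) :
    Differentiable ℝ g := hg.1.differentiable (by simp)

/-- Integration by parts against a smooth translated vector field. -/
lemma integral_div_temperate {k : Fin 3 → V3 → ℝ} {d : V3 → ℝ}
    (hk : ∀ j, (k j).HasTemperateGrowth) (hdiv : ∀ z, ∑ j, pd j (k j) z = d z)
    (F : SchwartzMap V3 ℝ) (w : V3) :
    ∫ v, ((∑ j, k j (v - w) * pd j F v) + d (v - w) * F v) = 0 := by
  set u : Fin 3 → SchwartzMap V3 ℝ :=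
    fun j => SchwartzMap.smulLeftCLM ℝ (fun v => k j (v - w)) F with hu
  have hpt : ∀ v, (∑ j, k j (v - w) * pd j F v) + d (v - w) * F v = ∑ j, pd j (u j) v := by
    intro v
    rw [← hdiv, Finset.sum_mul, ← Finset.sum_add_distrib]
    refine Finset.sum_congr rfl fun j _ => ?_
    have : ⇑(u j) = fun v => k j (v - w) * F v := by
      ext v; simp [hu, SchwartzMap.smulLeftCLM_apply_apply ((hk j).comp_sub w)]
    rw [this, pd_mul j ((hk j).comp_sub w).differentiable.differentiableAt F.differentiableAt,
      pd_comp_sub]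
    ring
  simp only [hpt]
  rw [integral_finsetSum _ fun j _ => ?_]
  · simp [SchwartzMap.integral_pd]
  · rw [SchwartzMap.coe_pd]; exact SchwartzMap.integrable _

lemma tendsto_integral_kernel {γ : ℝ} (hγ : -3 < γ) {K : ℕ → V3 → ℝ} {k F : V3 → ℝ} {C : ℝ}
    (hKm : ∀ n, Measurable (K n)) (hK : ∀ n z, z ≠ 0 → |K n z| ≤ C * majK γ z)
    (hlim : ∀ z, z ≠ 0 → Tendsto (fun n => K n z) atTop (nhds (k z))) (hF : Dec F) (w : V3) :
    Tendsto (fun n => ∫ v, K n (v - w) * F v) atTop (nhds (∫ v, k (v - w) * F v)) := by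
  have hmaj : KerBdd γ (majK γ) :=
    ⟨measurable_majK γ, 1, zero_le_one, fun z _ => by
      rw [abs_of_nonneg (majK_nonneg _ _), one_mul]⟩
  have hFa : Dec (fun v => |F v|) := by
    obtain ⟨hm, D, hD0, hD⟩ := hF
    exact ⟨hm.abs, D, hD0, fun w => by simpa using hD w⟩
  refine tendsto_integral_of_dominated_convergence (fun v => C * (majK γ (v - w) * |F v|))
    (fun n => (((hKm n).comp (by fun_prop)).mul hF.1).aestronglyMeasurable)
    ((hmaj.integrable_mul' hγ hFa w).const_mul C) (fun n => ?_) ?_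
  · filter_upwards [ae_sub_ne_zero' w] with v hv
    rw [Real.norm_eq_abs, abs_mul, ← mul_assoc]
    exact mul_le_mul_of_nonneg_right (hK n _ hv) (abs_nonneg _)
  · filter_upwards [ae_sub_ne_zero' w] with v hv
    exact (hlim _ hv).mul_const _

/-- A vector field with kernel-type singularity and divergence `d`, in the weak sense, convolved
with the Gaussian. -/
lemma gconv_weak_div {γ : ℝ} (hγ : -3 < γ) {k : Fin 3 → V3 → ℝ} {d : V3 → ℝ}
    {K : ℕ → Fin 3 → V3 → ℝ} {D : ℕ → V3 → ℝ} {C : ℝ} (hC : 0 ≤ C)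
    (hK : ∀ n j, (K n j).HasTemperateGrowth) (hdiv : ∀ n z, ∑ j, pd j (K n j) z = D n z)
    (hDm : ∀ n, Measurable (D n))
    (hKb : ∀ n j z, z ≠ 0 → |K n j z| ≤ C * majK γ z)
    (hDb : ∀ n z, z ≠ 0 → |D n z| ≤ C * majK γ z)
    (hKl : ∀ j z, z ≠ 0 → Tendsto (fun n => K n j z) atTop (nhds (k j z)))
    (hDl : ∀ z, z ≠ 0 → Tendsto (fun n => D n z) atTop (nhds (d z)))
    (hk : ∀ j, KerBdd γ (k j)) (hd : KerBdd γ d) (F : SchwartzMap V3 ℝ) :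
    Integrable (fun v => (∑ j, gconv (k j) v * pd j F v) + gconv d v * F v) ∧
    ∫ v, ((∑ j, gconv (k j) v * pd j F v) + gconv d v * F v) = 0 := by
  have hpd : ∀ j, Dec (pd j F) := fun j => SchwartzMap.dec (∂_{(EuclideanSpace.single j (1 : ℝ) : V3)} F)
  have hKm : ∀ n j, Measurable (K n j) := fun n j => (hK n j).1.continuous.measurable
  have hKk : ∀ n j, KerBdd γ (K n j) := fun n j => ⟨hKm n j, C, hC, hKb n j⟩
  have hDk : ∀ n, KerBdd γ (D n) := fun n => ⟨hDm n, C, hC, hDb n⟩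
  have hi : ∀ j, Integrable (fun v => gconv (k j) v * pd j F v) :=
    fun j => (hk j).integrable_gconv_mul hγ (hpd j)
  have hid : Integrable (fun v => gconv d v * F v) := hd.integrable_gconv_mul hγ F.dec
  have hw : ∀ w, (∑ j, ∫ v, k j (v - w) * pd j F v) + ∫ v, d (v - w) * F v = 0 := by
    intro w
    have h0 : ∀ n, (∑ j, ∫ v, K n j (v - w) * pd j F v) + ∫ v, D n (v - w) * F v = 0 := by
      intro n
      rw [← integral_div_temperate (hK n) (hdiv n) F w, integral_add, integral_finsetSum]
      · exact fun j _ => (hKk n j).integrable_mul' hγ (hpd j) w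
      · exact integrable_finsetSum _ fun j _ => (hKk n j).integrable_mul' hγ (hpd j) w
      · exact (hDk n).integrable_mul' hγ F.dec w
    refine tendsto_nhds_unique (f := fun n => (∑ j, ∫ v, K n j (v - w) * pd j F v) +
      ∫ v, D n (v - w) * F v) (l := atTop) ?_ (tendsto_const_nhds.congr fun n => (h0 n).symm)
    refine (tendsto_finsetSum _ fun j _ => ?_).add ?_
    · exact tendsto_integral_kernel hγ (fun n => hKm n j) (fun n => hKb n j) (hKl j) (hpd j) w
    · exact tendsto_integral_kernel hγ hDm hDb hDl F.dec w
  refine ⟨(integrable_finsetSum _ fun j _ => hi j).add hid, ?_⟩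
  rw [integral_add (integrable_finsetSum _ fun j _ => hi j) hid, integral_finsetSum _ fun j _ => hi j,
    hd.integral_gconv_mul hγ F.dec]
  simp only [fun j => (hk j).integral_gconv_mul hγ (hpd j)]
  rw [← integral_finsetSum _ fun j _ => (hk j).integrable_integral_mul hγ (hpd j),
    ← integral_add (integrable_finsetSum _ fun j _ => (hk j).integrable_integral_mul hγ (hpd j))
      (hd.integrable_integral_mul hγ F.dec)]
  simp only [← Finset.sum_mul, ← add_mul, hw, zero_mul, integral_zero]

lemma norm_sq_three (z : V3) : ‖z‖ ^ 2 = z 0 ^ 2 + z 1 ^ 2 + z 2 ^ 2 := by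
  rw [EuclideanSpace.real_norm_sq_eq, Fin.sum_univ_three]

lemma abs_coord_le (z : V3) (i : Fin 3) : |z i| ≤ ‖z‖ := by
  simpa using PiLp.norm_apply_le z i

lemma norm_rpow_mul_sq {γ : ℝ} {z : V3} (hz : z ≠ 0) : ‖z‖ ^ γ * ‖z‖ ^ 2 = ‖z‖ ^ (γ + 2) := by
  rw [Real.rpow_add (norm_pos_iff.2 hz)]; norm_cast

lemma norm_rpow_mul_self {γ : ℝ} {z : V3} (hz : z ≠ 0) : ‖z‖ ^ γ * ‖z‖ = ‖z‖ ^ (γ + 1) := by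
  rw [Real.rpow_add (norm_pos_iff.2 hz), Real.rpow_one]

lemma aker_eq {γ : ℝ} {z : V3} (hz : z ≠ 0) (i j : Fin 3) :
    aker γ z i j = ‖z‖ ^ γ * ((if i = j then ‖z‖ ^ 2 else 0) - z i * z j) := by
  have : ‖z‖ ≠ 0 := norm_ne_zero_iff.2 hz
  rw [aker, ← norm_rpow_mul_sq hz]
  split_ifs <;> field_simp
  ring

lemma aker_symm (γ : ℝ) (z : V3) (i j : Fin 3) : aker γ z i j = aker γ z j i := by
  simp only [aker, eq_comm, mul_comm]

lemma abs_projection_le (z : V3) (i j : Fin 3) :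
    |(if i = j then ‖z‖ ^ 2 else 0) - z i * z j| ≤ 2 * ‖z‖ ^ 2 := by
  have h1 : |z i * z j| ≤ ‖z‖ ^ 2 := by
    rw [abs_mul, sq]
    exact mul_le_mul (abs_coord_le z i) (abs_coord_le z j) (abs_nonneg _) (norm_nonneg _)
  have := abs_le.1 h1
  have h0 := sq_nonneg ‖z‖
  split_ifs <;> exact abs_le.2 ⟨by linarith, by linarith⟩

/-- Bound for `|z|^γ`-type kernels multiplied by the matrix `|z|² I - z ⊗ z`. -/
lemma abs_mul_projection_le {γ : ℝ} (h1 : -3 < γ) (h2 : γ < -2) {z : V3} (hz : z ≠ 0) {t : ℝ}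
    (ht : 0 ≤ t) (htz : t ≤ ‖z‖ ^ γ) (i j : Fin 3) :
    |t * ((if i = j then ‖z‖ ^ 2 else 0) - z i * z j)| ≤ 12 * majK γ z := by
  rw [abs_mul, abs_of_nonneg ht]
  have := rpow_norm_le_majK (γ := γ) (β := γ + 2) (by linarith) (by linarith) hz
  calc _ ≤ ‖z‖ ^ γ * (2 * ‖z‖ ^ 2) := mul_le_mul htz (abs_projection_le z i j) (abs_nonneg _)
        (by positivity)
    _ = 2 * ‖z‖ ^ (γ + 2) := by rw [← norm_rpow_mul_sq hz]; ring
    _ ≤ 12 * majK γ z := by linarith [majK_nonneg γ z]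

lemma abs_mul_coord_le {γ : ℝ} (h2 : γ < -2) {z : V3} (hz : z ≠ 0) {t : ℝ}
    (ht : 0 ≤ t) (htz : t ≤ ‖z‖ ^ γ) (i : Fin 3) :
    |t * (-2 * z i)| ≤ 12 * majK γ z := by
  rw [abs_mul, abs_of_nonneg ht, abs_mul]
  have := rpow_norm_le_majK (γ := γ) (β := γ + 1) (by linarith) (by linarith) hz
  calc _ ≤ ‖z‖ ^ γ * (2 * ‖z‖) := by
        refine mul_le_mul htz ?_ (by positivity) (by positivity)
        have := abs_coord_le z i
        norm_num; linarith
    _ = 2 * ‖z‖ ^ (γ + 1) := by rw [← norm_rpow_mul_self hz]; ring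
    _ ≤ 12 * majK γ z := by linarith [majK_nonneg γ z]

lemma measurable_coord (i : Fin 3) : Measurable (fun z : V3 => z i) :=
  (differentiable_coord i).continuous.measurable

lemma measurable_aker (γ : ℝ) (i j : Fin 3) : Measurable (fun z => aker γ z i j) := by
  have h1 := measurable_coord i
  have h2 := measurable_coord j
  unfold aker
  fun_prop

lemma measurable_bker (γ : ℝ) (i : Fin 3) : Measurable (fun z => bker γ z i) := by
  have h1 := measurable_coord i
  unfold bker
  fun_prop

lemma kerBdd_aker {γ : ℝ} (h1 : -3 < γ) (h2 : γ < -2) (i j : Fin 3) :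
    KerBdd γ (fun z => aker γ z i j) :=
  ⟨measurable_aker γ i j, 12, by norm_num, fun z hz => by
    simp only [aker_eq hz]
    exact abs_mul_projection_le h1 h2 hz (by positivity) le_rfl i j⟩

lemma kerBdd_bker {γ : ℝ} (h2 : γ < -2) (i : Fin 3) :
    KerBdd γ (fun z => bker γ z i) :=
  ⟨measurable_bker γ i, 12, by norm_num, fun z hz => by
    have := abs_mul_coord_le h2 hz (t := ‖z‖ ^ γ) (by positivity) le_rfl i
    rwa [show ‖z‖ ^ γ * (-2 * z i) = bker γ z i by unfold bker; ring] at this⟩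

lemma kerBdd_cker {γ : ℝ} (h1 : -3 < γ) (h2 : γ < -2) :
    KerBdd γ (fun z => -2 * (γ + 3) * ‖z‖ ^ γ) :=
  ⟨by fun_prop, 2, by norm_num, fun z hz => by
    have := rpow_norm_le_majK (γ := γ) (β := γ) le_rfl (by linarith) hz
    have h0 : 0 ≤ ‖z‖ ^ γ := by positivity
    exact abs_le.2 ⟨by nlinarith, by nlinarith⟩⟩

lemma cbar_eq_gconv (γ : ℝ) (v : V3) :
    cbar γ v = gconv (fun z => -2 * (γ + 3) * ‖z‖ ^ γ) v := by
  simp only [cbar, Jfun, gconv, mul_assoc, ← integral_const_mul]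

lemma wgt_le_norm_rpow {γ c : ℝ} (hγ : γ ≤ 0) (hc : 0 < c) {z : V3} (hz : z ≠ 0) :
    wgt c (γ / 2) z ≤ ‖z‖ ^ γ := by
  have h : 0 < ‖z‖ := norm_pos_iff.2 hz
  have : ‖z‖ ^ γ = (‖z‖ ^ 2) ^ (γ / 2) := by
    rw [← Real.rpow_natCast_mul h.le]; congr 1; push_cast; ring
  rw [this]
  exact Real.rpow_le_rpow_of_nonpos (by positivity) (by linarith) (by linarith)

lemma tendsto_wgt {p : ℝ} {z : V3} (hz : z ≠ 0) :
    Tendsto (fun n : ℕ => wgt (1 / ((n : ℝ) + 1)) p z) atTop (nhds (‖z‖ ^ (2 * p))) := by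
  have h : 0 < ‖z‖ := norm_pos_iff.2 hz
  have h1 : ‖z‖ ^ (2 * p) = (0 + ‖z‖ ^ 2) ^ p := by
    rw [zero_add, ← Real.rpow_natCast_mul h.le]; norm_num
  rw [h1]
  exact ((tendsto_one_div_add_atTop_nhds_zero_nat (𝕜 := ℝ)).add_const _).rpow_const
    (Or.inl (by positivity))

lemma wgt_add_one {c : ℝ} (hc : 0 < c) (p : ℝ) (z : V3) :
    wgt c p z = wgt c (p - 1) z * (c + ‖z‖ ^ 2) := by
  unfold wgt
  rw [Real.rpow_sub_one (by positivity)]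
  field_simp

lemma hasTemperateGrowth_projection (i j : Fin 3) : Function.HasTemperateGrowth
    (fun z : V3 => (if i = j then ‖z‖ ^ 2 else 0) - z i * z j) := by
  refine Function.HasTemperateGrowth.sub ?_
    ((hasTemperateGrowth_coord i).mul (hasTemperateGrowth_coord j))
  split_ifs
  · exact Function.hasTemperateGrowth_norm_sq V3
  · exact Function.HasTemperateGrowth.const 0

lemma differentiable_norm_sq : Differentiable ℝ (fun z : V3 => ‖z‖ ^ 2) :=
  fun v => (hasStrictFDerivAt_norm_sq v).hasFDerivAt.differentiableAt

lemma div_regularized_matrix {c : ℝ} (hc : 0 < c) (p : ℝ) (i : Fin 3) (z : V3) :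
    ∑ j, pd j (fun z => wgt c p z * ((if i = j then ‖z‖ ^ 2 else 0) - z i * z j)) z =
      wgt c p z * (-2 * z i) := by
  have h : ∀ j, pd j (fun z => wgt c p z * ((if i = j then ‖z‖ ^ 2 else 0) - z i * z j)) z =
      2 * p * z j * wgt c (p - 1) z * ((if i = j then ‖z‖ ^ 2 else 0) - z i * z j) +
      wgt c p z * ((if i = j then 2 * z j else 0) - ((if i = j then 1 else 0) * z j + z i)) := by
    intro j
    rw [pd_mul j (differentiable_wgt hc p z) ((hasTemperateGrowth_projection i j).differentiable.differentiableAt),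
      pd_wgt hc]
    congr 2
    have hd : DifferentiableAt ℝ (fun z : V3 => if i = j then ‖z‖ ^ 2 else 0) z := by
      split_ifs
      · exact differentiable_norm_sq z
      · fun_prop
    rw [pd_sub j hd (g := fun z => z i * z j)
        ((differentiable_coord i z).mul (differentiable_coord j z)),
      pd_mul j (differentiable_coord i z) (differentiable_coord j z), pd_coord, pd_coord]
    congr 1
    · split_ifs with hij
      · exact pd_norm_sq j z
      · simp [pd]
    · simp
  simp only [h, Fin.sum_univ_three]
  have := norm_sq_three z
  fin_cases i <;> simp <;> rw [this] <;> ring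

lemma div_regularized_vector {c : ℝ} (hc : 0 < c) (p : ℝ) (z : V3) :
    ∑ j, pd j (fun z => wgt c p z * (-2 * z j)) z =
      -2 * (3 * wgt c p z + 2 * p * (‖z‖ ^ 2 * wgt c (p - 1) z)) := by
  have h : ∀ j, pd j (fun z => wgt c p z * (-2 * z j)) z =
      2 * p * z j * wgt c (p - 1) z * (-2 * z j) + wgt c p z * (-2) := by
    intro j
    rw [pd_mul j (differentiable_wgt hc p z) ((differentiable_coord j z).const_mul (-2)),
      pd_wgt hc, pd_const_mul j _ (differentiable_coord j z), pd_coord]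
    simp
  simp only [h, Fin.sum_univ_three]
  rw [norm_sq_three z]; ring

/-- `∂_j ā_{ij} = b̄_i`, weakly against Schwartz functions. -/
lemma weak_div_abar {γ : ℝ} (h1 : -3 < γ) (h2 : γ < -2) (i : Fin 3) (F : SchwartzMap V3 ℝ) :
    Integrable (fun v => (∑ j, abar γ v i j * pd j F v) + bbar γ v i * F v) ∧
    ∫ v, ((∑ j, abar γ v i j * pd j F v) + bbar γ v i * F v) = 0 := by
  have hc : ∀ n : ℕ, 0 < 1 / ((n : ℝ) + 1) := fun n => by positivity
  have hl : ∀ z : V3, z ≠ 0 →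
      Tendsto (fun n : ℕ => wgt (1 / ((n : ℝ) + 1)) (γ / 2) z) atTop (nhds (‖z‖ ^ γ)) := by
    intro z hz
    have := tendsto_wgt (p := γ / 2) hz
    rwa [mul_div_cancel₀ γ two_ne_zero] at this
  refine gconv_weak_div (γ := γ) (C := 12) h1 (k := fun j z => aker γ z i j)
    (d := fun z => bker γ z i)
    (K := fun n j z => wgt (1 / ((n : ℝ) + 1)) (γ / 2) z *
      ((if i = j then ‖z‖ ^ 2 else 0) - z i * z j))
    (D := fun n z => wgt (1 / ((n : ℝ) + 1)) (γ / 2) z * (-2 * z i)) (by norm_num)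
    (fun n j => (hasTemperateGrowth_wgt (hc n) _).mul (hasTemperateGrowth_projection i j))
    (fun n z => div_regularized_matrix (hc n) _ i z)
    (fun n => (differentiable_wgt (hc n) _).continuous.measurable.mul
      ((measurable_coord i).const_mul _))
    (fun n j z hz => abs_mul_projection_le h1 h2 hz (wgt_pos (hc n) _ z).le
      (wgt_le_norm_rpow (by linarith) (hc n) hz) i j)
    (fun n z hz => abs_mul_coord_le h2 hz (wgt_pos (hc n) _ z).le
      (wgt_le_norm_rpow (by linarith) (hc n) hz) i)
    (fun j z hz => ?_) (fun z hz => ?_) (fun j => kerBdd_aker h1 h2 i j) (kerBdd_bker h2 i) F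
  · rw [aker_eq hz]
    exact (hl z hz).mul_const _
  · rw [show bker γ z i = ‖z‖ ^ γ * (-2 * z i) by unfold bker; ring]
    exact (hl z hz).mul_const _

/-- `∂_i b̄_i = c̄`, weakly against Schwartz functions. -/
lemma weak_div_bbar {γ : ℝ} (h1 : -3 < γ) (h2 : γ < -2) (F : SchwartzMap V3 ℝ) :
    Integrable (fun v => (∑ j, bbar γ v j * pd j F v) + cbar γ v * F v) ∧
    ∫ v, ((∑ j, bbar γ v j * pd j F v) + cbar γ v * F v) = 0 := by
  have hc : ∀ n : ℕ, 0 < 1 / ((n : ℝ) + 1) := fun n => by positivity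
  have hl : ∀ z : V3, z ≠ 0 →
      Tendsto (fun n : ℕ => wgt (1 / ((n : ℝ) + 1)) (γ / 2) z) atTop (nhds (‖z‖ ^ γ)) := by
    intro z hz
    have := tendsto_wgt (p := γ / 2) hz
    rwa [mul_div_cancel₀ γ two_ne_zero] at this
  simp only [cbar_eq_gconv]
  refine gconv_weak_div (γ := γ) (C := 12) h1 (k := fun j z => bker γ z j)
    (d := fun z => -2 * (γ + 3) * ‖z‖ ^ γ)
    (K := fun n j z => wgt (1 / ((n : ℝ) + 1)) (γ / 2) z * (-2 * z j))
    (D := fun n z => -2 * (3 * wgt (1 / ((n : ℝ) + 1)) (γ / 2) z +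
      2 * (γ / 2) * (‖z‖ ^ 2 * wgt (1 / ((n : ℝ) + 1)) (γ / 2 - 1) z))) (by norm_num)
    (fun n j => (hasTemperateGrowth_wgt (hc n) _).mul
      ((Function.HasTemperateGrowth.const (-2)).mul (hasTemperateGrowth_coord j)))
    (fun n z => div_regularized_vector (hc n) _ z)
    (fun n => ?_)
    (fun n j z hz => abs_mul_coord_le h2 hz (wgt_pos (hc n) _ z).le
      (wgt_le_norm_rpow (by linarith) (hc n) hz) j)
    (fun n z hz => ?_)
    (fun j z hz => ?_) (fun z hz => ?_) (fun j => kerBdd_bker h2 j) (kerBdd_cker h1 h2) F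
  · have e1 := (differentiable_wgt (hc n) (γ / 2)).continuous.measurable
    have e2 := (differentiable_wgt (hc n) (γ / 2 - 1)).continuous.measurable
    fun_prop
  · have e1 := wgt_pos (hc n) (γ / 2) z
    have e2 := wgt_pos (hc n) (γ / 2 - 1) z
    have e3 := wgt_add_one (hc n) (γ / 2) z
    have e4 := wgt_le_norm_rpow (γ := γ) (by linarith) (hc n) hz
    have e5 := rpow_norm_le_majK (γ := γ) (β := γ) le_rfl (by linarith) hz
    have e6 : ‖z‖ ^ 2 * wgt (1 / ((n : ℝ) + 1)) (γ / 2 - 1) z ≤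
        wgt (1 / ((n : ℝ) + 1)) (γ / 2) z := by nlinarith [hc n]
    have e7 : 0 ≤ ‖z‖ ^ 2 * wgt (1 / ((n : ℝ) + 1)) (γ / 2 - 1) z := by positivity
    generalize ‖z‖ ^ 2 * wgt (1 / ((n : ℝ) + 1)) (γ / 2 - 1) z = x at *
    generalize wgt (1 / ((n : ℝ) + 1)) (γ / 2) z = y at *
    exact abs_le.2 ⟨by nlinarith, by nlinarith⟩
  · rw [show bker γ z j = ‖z‖ ^ γ * (-2 * z j) by unfold bker; ring]
    exact (hl z hz).mul_const _
  · have e1 := tendsto_wgt (p := γ / 2 - 1) hz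
    have e2 : ‖z‖ ^ 2 * ‖z‖ ^ (2 * (γ / 2 - 1)) = ‖z‖ ^ γ := by
      rw [mul_comm, norm_rpow_mul_sq hz]; congr 1; ring
    have e3 := (((hl z hz).const_mul 3).add ((e1.const_mul (‖z‖ ^ 2)).const_mul
      (2 * (γ / 2)))).const_mul (-2)
    rw [e2] at e3
    convert! e3 using 2
    ring

/-- Squared norm of the cross product, in coordinates. -/
def crossq (a b : V3) : ℝ :=
  (a 1 * b 2 - a 2 * b 1) ^ 2 + (a 2 * b 0 - a 0 * b 2) ^ 2 + (a 0 * b 1 - a 1 * b 0) ^ 2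

lemma crossq_nonneg (a b : V3) : 0 ≤ crossq a b := by unfold crossq; positivity

lemma crossq_le (a b : V3) : crossq a b ≤ ‖a‖ ^ 2 * ‖b‖ ^ 2 := by
  rw [norm_sq_three, norm_sq_three, crossq]
  nlinarith [sq_nonneg (a 0 * b 0 + a 1 * b 1 + a 2 * b 2)]

lemma crossq_sub_self (v w : V3) : crossq (v - w) v = crossq w v := by
  simp only [crossq, PiLp.sub_apply]; ring

/-- Reflection of the `i`-th coordinate. -/
def flipCoord (i : Fin 3) : V3 ≃ₗᵢ[ℝ] V3 :=
  LinearIsometryEquiv.piLpCongrRight 2 fun j =>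
    if j = i then LinearIsometryEquiv.neg ℝ else LinearIsometryEquiv.refl ℝ ℝ

lemma flipCoord_apply (i j : Fin 3) (w : V3) :
    flipCoord i w j = if j = i then -w j else w j := by
  simp only [flipCoord, LinearIsometryEquiv.piLpCongrRight_apply]
  split_ifs with h <;> simp [h]

lemma integral_eq_zero_of_flip (i : Fin 3) {g : V3 → ℝ} (hg : ∀ w, g (flipCoord i w) = -g w) :
    ∫ w, g w = 0 := by
  have h := (flipCoord i).measurePreserving.integral_comp
    (flipCoord i).toHomeomorph.measurableEmbedding g
  simp only [hg, integral_neg] at h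
  linarith

/-- The radial density `⟨w⟩^γ μ(w)`. -/
def radG (γ : ℝ) (w : V3) : ℝ := wgt 1 (γ / 2) w * gaussM w

lemma radG_pos (γ : ℝ) (w : V3) : 0 < radG γ w := mul_pos (wgt_pos one_pos _ _) (gaussM_pos w)

lemma continuous_radG (γ : ℝ) : Continuous (radG γ) := by
  have h1 := (differentiable_wgt one_pos (γ / 2)).continuous
  unfold radG gaussM
  fun_prop

lemma radG_flip (γ : ℝ) (i : Fin 3) (w : V3) : radG γ (flipCoord i w) = radG γ w := by
  simp [radG, wgt, gaussM]

lemma wgt_one_le_one {p : ℝ} (hp : p ≤ 0) (v : V3) : wgt 1 p v ≤ 1 :=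
  Real.rpow_le_one_of_one_le_of_nonpos (by nlinarith [sq_nonneg ‖v‖]) hp

lemma dec_radG_mul {γ : ℝ} (hγ : γ ≤ 0) {q : V3 → ℝ} (hq : Measurable q)
    (hb : ∀ w, |q w| ≤ 1 + ‖w‖ ^ 2) : Dec (fun w => radG γ w * q w) := by
  obtain ⟨-, C, hC0, hC⟩ := dec_rpow_mul_gaussM (p := 1) (by norm_num)
  refine ⟨(continuous_radG γ).measurable.mul hq, C, hC0, fun w => le_trans ?_ (hC w)⟩
  have h1 := wgt_one_le_one (p := γ / 2) (by linarith) w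
  have h2 := wgt_pos one_pos (γ / 2) w
  have h3 := gaussM_pos w
  refine le_trans ?_ (le_abs_self _)
  beta_reduce
  rw [Real.rpow_one, abs_mul, abs_of_pos (radG_pos γ w), radG]
  calc _ ≤ (1 * gaussM w) * (1 + ‖w‖ ^ 2) :=
        mul_le_mul (mul_le_mul_of_nonneg_right h1 h3.le) (hb w) (abs_nonneg _) (by positivity)
    _ = _ := by ring

lemma integrable_radG_mul {γ : ℝ} (hγ : γ ≤ 0) {q : V3 → ℝ} (hq : Measurable q)
    (hb : ∀ w, |q w| ≤ 1 + ‖w‖ ^ 2) : Integrable (fun w => radG γ w * q w) :=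
  (dec_radG_mul hγ hq hb).integrable

lemma abs_coord_le_one_add_sq (i : Fin 3) (w : V3) : |w i| ≤ 1 + ‖w‖ ^ 2 := by
  nlinarith [abs_coord_le w i, sq_nonneg (‖w‖ - 1)]

lemma abs_coord_mul_le_one_add_sq (i j : Fin 3) (w : V3) : |w i * w j| ≤ 1 + ‖w‖ ^ 2 := by
  rw [abs_mul]
  nlinarith [abs_coord_le w i, abs_coord_le w j, abs_nonneg (w i), abs_nonneg (w j), norm_nonneg w]

lemma integral_radG_pos {γ : ℝ} (hγ : γ ≤ 0) : 0 < ∫ w, radG γ w := by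
  have hi : Integrable (radG γ) := by
    simpa using integrable_radG_mul hγ (q := fun _ => 1) measurable_const
      (fun w => by simp)
  exact integral_pos_of_integrable_nonneg_nonzero (x := 0) (continuous_radG γ) hi
    (fun w => (radG_pos γ w).le) (radG_pos γ 0).ne'

lemma integral_radG_coord_sq_pos {γ : ℝ} (hγ : γ ≤ 0) (i : Fin 3) :
    0 < ∫ w : V3, radG γ w * (w i * w i) := by
  refine integral_pos_of_integrable_nonneg_nonzero (x := EuclideanSpace.single i 1)
    ((continuous_radG γ).mul ((differentiable_coord i).continuous.mul
      (differentiable_coord i).continuous))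
    (integrable_radG_mul hγ ((measurable_coord i).mul (measurable_coord i))
      (abs_coord_mul_le_one_add_sq i i))
    (fun w => mul_nonneg (radG_pos γ w).le (mul_self_nonneg _)) ?_
  simpa using (radG_pos γ _).ne'

/-- `f` is integrable with integral `a`. -/
def HasInt (f : V3 → ℝ) (a : ℝ) : Prop := Integrable f ∧ ∫ v, f v = a

lemma HasInt.add {f g : V3 → ℝ} {a b : ℝ} (hf : HasInt f a) (hg : HasInt g b) :
    HasInt (fun v => f v + g v) (a + b) :=
  ⟨hf.1.add hg.1, by rw [integral_add hf.1 hg.1, hf.2, hg.2]⟩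

lemma HasInt.const_mul {f : V3 → ℝ} {a : ℝ} (c : ℝ) (hf : HasInt f a) :
    HasInt (fun v => c * f v) (c * a) :=
  ⟨hf.1.const_mul c, by rw [integral_const_mul, hf.2]⟩

lemma HasInt.sum {f : Fin 3 → V3 → ℝ} {a : Fin 3 → ℝ} (hf : ∀ i, HasInt (f i) (a i)) :
    HasInt (fun v => ∑ i, f i v) (∑ i, a i) :=
  ⟨integrable_finsetSum _ fun i _ => (hf i).1, by
    rw [integral_finsetSum _ fun i _ => (hf i).1]; simp only [fun i => (hf i).2]⟩

lemma HasInt.congr {f g : V3 → ℝ} {a : ℝ} (hf : HasInt f a) (h : ∀ v, g v = f v) :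
    HasInt g a := by
  rwa [show g = f from funext h]

lemma hasInt_radG_mul_crossq {γ : ℝ} (hγ : γ ≤ 0) (v x : V3) :
    HasInt (fun w => radG γ w * crossq (v - w) x)
      (crossq v x * (∫ w, radG γ w)
        + (x 1 ^ 2 + x 2 ^ 2) * (∫ w : V3, radG γ w * (w 0 * w 0))
        + (x 0 ^ 2 + x 2 ^ 2) * (∫ w : V3, radG γ w * (w 1 * w 1))
        + (x 0 ^ 2 + x 1 ^ 2) * (∫ w : V3, radG γ w * (w 2 * w 2))) := by
  have h0 : HasInt (radG γ) (∫ w, radG γ w) :=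
    ⟨by simpa using integrable_radG_mul hγ (q := fun _ => 1) measurable_const (fun w => by simp),
      rfl⟩
  have h1 : ∀ i, HasInt (fun w : V3 => radG γ w * w i) 0 := fun i =>
    ⟨integrable_radG_mul hγ (measurable_coord i) (abs_coord_le_one_add_sq i),
      integral_eq_zero_of_flip i fun w => by simp [radG_flip, flipCoord_apply]⟩
  have h2 : ∀ i j, HasInt (fun w : V3 => radG γ w * (w i * w j))
      (∫ w : V3, radG γ w * (w i * w j)) := fun i j =>
    ⟨integrable_radG_mul hγ ((measurable_coord i).mul (measurable_coord j))
      (abs_coord_mul_le_one_add_sq i j), rfl⟩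
  have h3 : ∀ i j, i ≠ j → HasInt (fun w : V3 => radG γ w * (w i * w j)) 0 := fun i j hij =>
    ⟨(h2 i j).1, integral_eq_zero_of_flip i fun w => by
      simp [radG_flip, flipCoord_apply, hij.symm]⟩
  have key := ((((((((((h0.const_mul (crossq v x)).add
    ((h2 0 0).const_mul (x 1 ^ 2 + x 2 ^ 2))).add
    ((h2 1 1).const_mul (x 0 ^ 2 + x 2 ^ 2))).add
    ((h2 2 2).const_mul (x 0 ^ 2 + x 1 ^ 2))).add
    ((h1 0).const_mul (-2 * ((v 0 * x 1 - v 1 * x 0) * x 1 - (v 2 * x 0 - v 0 * x 2) * x 2)))).add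
    ((h1 1).const_mul (-2 * ((v 1 * x 2 - v 2 * x 1) * x 2 - (v 0 * x 1 - v 1 * x 0) * x 0)))).add
    ((h1 2).const_mul (-2 * ((v 2 * x 0 - v 0 * x 2) * x 0 - (v 1 * x 2 - v 2 * x 1) * x 1)))).add
    ((h3 0 1 (by decide)).const_mul (-2 * x 0 * x 1))).add
    ((h3 0 2 (by decide)).const_mul (-2 * x 0 * x 2))).add
    ((h3 1 2 (by decide)).const_mul (-2 * x 1 * x 2)))
  simp only [mul_zero, add_zero] at key
  refine key.congr fun w => ?_
  simp only [crossq, PiLp.sub_apply]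
  ring

/-- Lower bound `|v-w|^γ ≳ ⟨v⟩^γ ⟨w⟩^γ`. -/
lemma le_norm_sub_rpow {γ : ℝ} (hγ : γ ≤ 0) {v w : V3} (h : v - w ≠ 0) :
    2 ^ (γ / 2) * wgt 1 (γ / 2) v * wgt 1 (γ / 2) w ≤ ‖v - w‖ ^ γ := by
  have h0 : 0 < ‖v - w‖ := norm_pos_iff.2 h
  have e : ‖v - w‖ ^ γ = (‖v - w‖ ^ 2) ^ (γ / 2) := by
    rw [← Real.rpow_natCast_mul h0.le]; congr 1; push_cast; ring
  unfold wgt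
  rw [e, ← Real.mul_rpow (by norm_num) (by positivity),
    ← Real.mul_rpow (by positivity) (by positivity)]
  refine Real.rpow_le_rpow_of_nonpos (by positivity) ?_ (by linarith)
  have h1 := norm_sub_le v w
  nlinarith [sq_nonneg (‖v‖ - ‖w‖), mul_nonneg (sq_nonneg ‖v‖) (sq_nonneg ‖w‖), h0.le,
    norm_nonneg v, norm_nonneg w]

lemma sum_aker_mul {γ : ℝ} {z : V3} (hz : z ≠ 0) (x : V3) :
    ∑ i, ∑ j, aker γ z i j * x i * x j = ‖z‖ ^ γ * crossq z x := by
  simp only [aker_eq hz, Fin.sum_univ_three, norm_sq_three, crossq]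
  simp
  ring

lemma hasInt_gconv {γ : ℝ} (h1 : -3 < γ) {k : V3 → ℝ} (hk : KerBdd γ k) (v : V3) :
    HasInt (fun w => k (v - w) * gaussM w) (gconv k v) :=
  ⟨hk.integrable_mul h1 dec_gaussM v, rfl⟩

/-- Anisotropic coercivity of `ā`. -/
lemma abar_coercive {γ : ℝ} (h1 : -3 < γ) (h2 : γ < -2) :
    ∃ c > 0, ∀ v x : V3, c * (wgt 1 (γ / 2) v * (‖x‖ ^ 2 + crossq v x)) ≤
      ∑ i, ∑ j, abar γ v i j * x i * x j := by
  have hγ : γ ≤ 0 := by linarith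
  have p0 := integral_radG_pos hγ
  have q0 := integral_radG_coord_sq_pos hγ 0
  have q1 := integral_radG_coord_sq_pos hγ 1
  have q2 := integral_radG_coord_sq_pos hγ 2
  have hm := fun v x => hasInt_radG_mul_crossq hγ v x
  set g0 := ∫ w, radG γ w
  set g1 := ∫ w : V3, radG γ w * (w 0 * w 0)
  set g2 := ∫ w : V3, radG γ w * (w 1 * w 1)
  set g3 := ∫ w : V3, radG γ w * (w 2 * w 2)
  obtain ⟨m, hm0, m0, m1, m2, m3⟩ : ∃ m > 0, m ≤ g0 ∧ m ≤ g1 ∧ m ≤ g2 ∧ m ≤ g3 :=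
    ⟨min (min g0 g1) (min g2 g3), by positivity, by simp, by simp, by simp, by simp⟩
  have hκ : (0 : ℝ) < 2 ^ (γ / 2) := by positivity
  refine ⟨2 ^ (γ / 2) * m, by positivity, fun v x => ?_⟩
  have hW := wgt_pos one_pos (γ / 2) v
  have hA : HasInt (fun w => (∑ i, ∑ j, aker γ (v - w) i j * x i * x j) * gaussM w)
      (∑ i, ∑ j, abar γ v i j * x i * x j) := by
    have := HasInt.sum fun i => HasInt.sum fun j =>
      (hasInt_gconv h1 (kerBdd_aker h1 h2 i j) v).const_mul (x i * x j)
    convert! this.congr (g := fun w => (∑ i, ∑ j, aker γ (v - w) i j * x i * x j) * gaussM w)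
      (fun w => ?_) using 1
    · refine Finset.sum_congr rfl fun i _ => Finset.sum_congr rfl fun j _ => ?_
      rw [abar, gconv]; ring
    · simp only [Finset.sum_mul]
      refine Finset.sum_congr rfl fun i _ => Finset.sum_congr rfl fun j _ => ?_
      ring
  have hB := (hm v x).const_mul (2 ^ (γ / 2) * wgt 1 (γ / 2) v)
  have hle := integral_mono_ae hB.1 hA.1 (by
    filter_upwards [ae_sub_ne_zero v] with w hw
    rw [sum_aker_mul hw, radG]
    calc _ = (2 ^ (γ / 2) * wgt 1 (γ / 2) v * wgt 1 (γ / 2) w) *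
          (crossq (v - w) x * gaussM w) := by ring
      _ ≤ ‖v - w‖ ^ γ * (crossq (v - w) x * gaussM w) :=
          mul_le_mul_of_nonneg_right (le_norm_sub_rpow hγ hw)
            (mul_nonneg (crossq_nonneg _ _) (gaussM_nonneg w))
      _ = _ := by ring)
  rw [hA.2, hB.2] at hle
  refine le_trans ?_ hle
  rw [norm_sq_three x, show ∀ a : ℝ, 2 ^ (γ / 2) * m * (wgt 1 (γ / 2) v * a) =
    2 ^ (γ / 2) * wgt 1 (γ / 2) v * (m * a) from fun a => by ring]
  refine mul_le_mul_of_nonneg_left ?_ (by positivity)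
  nlinarith [mul_nonneg (sub_nonneg.2 m0) (crossq_nonneg v x), sq_nonneg (x 0), sq_nonneg (x 1),
    sq_nonneg (x 2), mul_nonneg (sub_nonneg.2 m1) (sq_nonneg (x 1)),
    mul_nonneg (sub_nonneg.2 m1) (sq_nonneg (x 2)), mul_nonneg (sub_nonneg.2 m2) (sq_nonneg (x 0)),
    mul_nonneg (sub_nonneg.2 m2) (sq_nonneg (x 2)), mul_nonneg (sub_nonneg.2 m3) (sq_nonneg (x 0)),
    mul_nonneg (sub_nonneg.2 m3) (sq_nonneg (x 1)), mul_nonneg hm0.le (sq_nonneg (x 0)),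
    mul_nonneg hm0.le (sq_nonneg (x 1)), mul_nonneg hm0.le (sq_nonneg (x 2))]

/-- First derivatives of the weight `⟨v⟩^{2k}`. -/
def wgtD (k : ℝ) (i : Fin 3) (v : V3) : ℝ := 2 * k * v i * wgt 1 (k - 1) v

/-- Second derivatives of the weight `⟨v⟩^{2k}`. -/
def wgtDD (k : ℝ) (i j : Fin 3) (v : V3) : ℝ :=
  2 * k * (if i = j then 1 else 0) * wgt 1 (k - 1) v + 4 * k * (k - 1) * v i * v j * wgt 1 (k - 2) v

/-- The zeroth order coefficient appearing in the weighted energy identity. -/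
def zerothCoeff (γ k : ℝ) (v : V3) : ℝ :=
  1 / 2 * (∑ i, ∑ j, abar γ v i j * wgtDD k i j v) + (∑ i, bbar γ v i * wgtD k i v)
    - 1 / 2 * (cbar γ v * wgt 1 k v)

lemma wgt_comparison {γ : ℝ} (h1 : -3 < γ) (h2 : γ < -2) {v w : V3} (h : v - w ≠ 0) :
    ‖v - w‖ ^ γ * (1 + ‖w‖ ^ 2) ≤
      4 ^ (-γ / 2) * wgt 1 (γ / 2) v * (majK γ (v - w) * (1 + ‖w‖ ^ 2) ^ (3 : ℝ)) := by
  set z := v - w with hz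
  have h0 : 0 < ‖z‖ := norm_pos_iff.2 h
  have hM := majK_nonneg γ z
  have ha : (1 + ‖z‖ ^ 2) ^ (-γ / 2) * ‖z‖ ^ γ ≤ 2 ^ (-γ / 2) * majK γ z := by
    have e : ‖z‖ ^ γ = ((‖z‖ ^ 2)⁻¹) ^ (-γ / 2) := by
      rw [Real.inv_rpow (by positivity), ← Real.rpow_neg (by positivity),
        ← Real.rpow_natCast_mul h0.le]
      congr 1; push_cast; ring
    rcases le_or_gt ‖z‖ 1 with hle | hgt
    · refine mul_le_mul ?_ (rpow_norm_le_majK le_rfl (by linarith) h) (by positivity)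
        (by positivity)
      exact Real.rpow_le_rpow (by positivity) (by nlinarith) (by linarith)
    · rw [e, ← Real.mul_rpow (by positivity) (by positivity)]
      refine le_trans (Real.rpow_le_rpow (z := -γ / 2) (by positivity) ?_ (by linarith))
        (le_mul_of_one_le_right (by positivity) (one_le_majK γ z))
      rw [← div_eq_mul_inv, div_le_iff₀ (by positivity)]
      nlinarith
  have hb : (1 : ℝ) ≤ 2 ^ (-γ / 2) * wgt 1 (γ / 2) v *
      ((1 + ‖z‖ ^ 2) ^ (-γ / 2) * (1 + ‖w‖ ^ 2) ^ (-γ / 2)) := by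
    have e : wgt 1 (γ / 2) v = ((1 + ‖v‖ ^ 2)⁻¹) ^ (-γ / 2) := by
      rw [Real.inv_rpow (by positivity), ← Real.rpow_neg (by positivity), wgt]
      congr 1; ring
    rw [e, ← Real.mul_rpow (by positivity) (by positivity),
      ← Real.mul_rpow (by positivity) (by positivity),
      ← Real.mul_rpow (by positivity) (by positivity)]
    refine Real.one_le_rpow ?_ (by linarith)
    rw [show 2 * (1 + ‖v‖ ^ 2)⁻¹ * ((1 + ‖z‖ ^ 2) * (1 + ‖w‖ ^ 2)) =
      2 * ((1 + ‖z‖ ^ 2) * (1 + ‖w‖ ^ 2)) / (1 + ‖v‖ ^ 2) by field_simp, le_div_iff₀ (by positivity)]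
    have hv : ‖v‖ ≤ ‖z‖ + ‖w‖ := by
      have := norm_add_le z w
      rwa [hz, sub_add_cancel] at this
    nlinarith [sq_nonneg (‖z‖ - ‖w‖), mul_nonneg (sq_nonneg ‖z‖) (sq_nonneg ‖w‖), norm_nonneg v]
  have hc : (1 + ‖w‖ ^ 2) ^ (-γ / 2) * (1 + ‖w‖ ^ 2) ≤ (1 + ‖w‖ ^ 2) ^ (3 : ℝ) := by
    rw [← Real.rpow_add_one (by positivity)]
    exact Real.rpow_le_rpow_of_exponent_le (by nlinarith [sq_nonneg ‖w‖]) (by linarith)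
  have hW := wgt_pos one_pos (γ / 2) v
  have h4 : (4 : ℝ) ^ (-γ / 2) = 2 ^ (-γ / 2) * 2 ^ (-γ / 2) := by
    rw [← Real.mul_rpow (by norm_num) (by norm_num)]; norm_num
  calc ‖z‖ ^ γ * (1 + ‖w‖ ^ 2) ≤ (2 ^ (-γ / 2) * wgt 1 (γ / 2) v *
        ((1 + ‖z‖ ^ 2) ^ (-γ / 2) * (1 + ‖w‖ ^ 2) ^ (-γ / 2))) * (‖z‖ ^ γ * (1 + ‖w‖ ^ 2)) :=
        le_mul_of_one_le_left (by positivity) hb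
    _ = 2 ^ (-γ / 2) * wgt 1 (γ / 2) v * (((1 + ‖z‖ ^ 2) ^ (-γ / 2) * ‖z‖ ^ γ) *
        ((1 + ‖w‖ ^ 2) ^ (-γ / 2) * (1 + ‖w‖ ^ 2))) := by ring
    _ ≤ 2 ^ (-γ / 2) * wgt 1 (γ / 2) v * ((2 ^ (-γ / 2) * majK γ z) *
        (1 + ‖w‖ ^ 2) ^ (3 : ℝ)) := by gcongr
    _ = _ := by rw [h4]; ring

lemma dec_sq_mul_gaussM : Dec (fun w : V3 => (1 + ‖w‖ ^ 2) * gaussM w) := by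
  simpa using dec_rpow_mul_gaussM (p := 1) (by norm_num)

lemma exists_integral_norm_rpow_mul_le {γ : ℝ} (h1 : -3 < γ) (h2 : γ < -2) :
    ∃ C > 0, ∀ v : V3, ∫ w, ‖v - w‖ ^ γ * ((1 + ‖w‖ ^ 2) * gaussM w) ≤ C * wgt 1 (γ / 2) v := by
  obtain ⟨C, hC0, hC⟩ := exists_integral_majK_mul_decD_le h1
  obtain ⟨-, D, hD0, hD⟩ := dec_rpow_mul_gaussM (p := 3) le_rfl
  refine ⟨4 ^ (-γ / 2) * D * C + 1, by positivity, fun v => ?_⟩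
  have hW := wgt_pos one_pos (γ / 2) v
  calc ∫ w, ‖v - w‖ ^ γ * ((1 + ‖w‖ ^ 2) * gaussM w)
      ≤ ∫ w, 4 ^ (-γ / 2) * wgt 1 (γ / 2) v * D * (majK γ (v - w) * decD w) := by
        refine integral_mono_ae ((kerBdd_norm_rpow le_rfl (by linarith)).integrable_mul h1
          dec_sq_mul_gaussM v) ((integrable_majK_mul_decD h1 v).const_mul _) ?_
        filter_upwards [ae_sub_ne_zero v] with w hw
        have hg := gaussM_pos w
        have hM := majK_nonneg γ (v - w)
        calc _ = ‖v - w‖ ^ γ * (1 + ‖w‖ ^ 2) * gaussM w := by ring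
          _ ≤ (4 ^ (-γ / 2) * wgt 1 (γ / 2) v * (majK γ (v - w) * (1 + ‖w‖ ^ 2) ^ (3 : ℝ))) *
              gaussM w := mul_le_mul_of_nonneg_right (wgt_comparison h1 h2 hw) hg.le
          _ = 4 ^ (-γ / 2) * wgt 1 (γ / 2) v * majK γ (v - w) *
              ((1 + ‖w‖ ^ 2) ^ (3 : ℝ) * gaussM w) := by ring
          _ ≤ 4 ^ (-γ / 2) * wgt 1 (γ / 2) v * majK γ (v - w) * (D * decD w) :=
              mul_le_mul_of_nonneg_left (le_trans (le_abs_self _) (hD w)) (by positivity)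
          _ = _ := by ring
    _ = 4 ^ (-γ / 2) * wgt 1 (γ / 2) v * D * ∫ w, majK γ (v - w) * decD w :=
        integral_const_mul _ _
    _ ≤ 4 ^ (-γ / 2) * wgt 1 (γ / 2) v * D * C :=
        mul_le_mul_of_nonneg_left (hC v) (by positivity)
    _ ≤ _ := by nlinarith

lemma le_integral_norm_rpow {γ : ℝ} (h1 : -3 < γ) (h2 : γ < -2) (v : V3) :
    2 ^ (γ / 2) * (∫ w, radG γ w) * wgt 1 (γ / 2) v ≤ ∫ w, ‖v - w‖ ^ γ * gaussM w := by
  rw [show 2 ^ (γ / 2) * (∫ w, radG γ w) * wgt 1 (γ / 2) v =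
    ∫ w, 2 ^ (γ / 2) * wgt 1 (γ / 2) v * radG γ w by rw [integral_const_mul]; ring]
  have hi : Integrable (radG γ) := by
    simpa using integrable_radG_mul (γ := γ) (by linarith) (q := fun _ => 1) measurable_const
      (fun w => by simp)
  refine integral_mono_ae (hi.const_mul _)
    ((kerBdd_norm_rpow le_rfl (by linarith)).integrable_mul h1 dec_gaussM v) ?_
  filter_upwards [ae_sub_ne_zero v] with w hw
  calc _ = 2 ^ (γ / 2) * wgt 1 (γ / 2) v * wgt 1 (γ / 2) w * gaussM w := by rw [radG]; ring
    _ ≤ _ := mul_le_mul_of_nonneg_right (le_norm_sub_rpow (by linarith) hw) (gaussM_nonneg w)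

lemma zerothCoeff_integrand_le {γ k : ℝ} (hk : 0 < k) {v w : V3} (h : v - w ≠ 0) :
    1 / 2 * (∑ i, ∑ j, aker γ (v - w) i j * wgtDD k i j v)
      + (∑ i, bker γ (v - w) i * wgtD k i v) - 1 / 2 * (-2 * (γ + 3) * ‖v - w‖ ^ γ * wgt 1 k v) ≤
    wgt 1 (k - 1) v * (‖v - w‖ ^ γ * (-(2 * k - γ - 3) * (1 + ‖v‖ ^ 2)
      + (2 * k + 2 * k ^ 2) * (1 + ‖w‖ ^ 2))) := by
  have e1 := wgt_add_one one_pos k v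
  have e2 := wgt_add_one one_pos (k - 1) v
  rw [show k - 1 - 1 = k - 2 by ring] at e2
  have hX0 := crossq_nonneg w v
  have hX := crossq_le w v
  have hu := wgt_pos one_pos (k - 2) v
  have key : 1 / 2 * (∑ i, ∑ j, aker γ (v - w) i j * wgtDD k i j v)
      + (∑ i, bker γ (v - w) i * wgtD k i v) - 1 / 2 * (-2 * (γ + 3) * ‖v - w‖ ^ γ * wgt 1 k v) =
      wgt 1 (k - 2) v * ‖v - w‖ ^ γ * (2 * k * (1 + ‖v‖ ^ 2) * (1 + ‖w‖ ^ 2)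
        - (2 * k - γ - 3) * (1 + ‖v‖ ^ 2) ^ 2 + 2 * k * (k - 1) * crossq w v) := by
    rw [← crossq_sub_self]
    simp only [wgtDD, wgtD]
    rw [e1, e2]
    simp only [aker_eq h, bker, Fin.sum_univ_three, norm_sq_three, crossq, PiLp.sub_apply]
    simp
    ring
  rw [key, e2]
  calc _ ≤ wgt 1 (k - 2) v * ‖v - w‖ ^ γ * (2 * k * (1 + ‖v‖ ^ 2) * (1 + ‖w‖ ^ 2)
        - (2 * k - γ - 3) * (1 + ‖v‖ ^ 2) ^ 2
        + 2 * k ^ 2 * ((1 + ‖v‖ ^ 2) * (1 + ‖w‖ ^ 2))) := by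
        refine mul_le_mul_of_nonneg_left ?_ (by positivity)
        have hX' : crossq w v ≤ (1 + ‖v‖ ^ 2) * (1 + ‖w‖ ^ 2) := by
          nlinarith [sq_nonneg ‖v‖, sq_nonneg ‖w‖]
        nlinarith [mul_nonneg hk.le hX0, mul_le_mul_of_nonneg_left hX' (sq_nonneg k)]
    _ = _ := by ring

/-- Strict negativity of the zeroth order coefficient for large velocities. -/
lemma exists_zerothCoeff_le {γ k : ℝ} (h1 : -3 < γ) (h2 : γ < -2) (hk : (γ + 3) / 2 < k) :
    ∃ c > 0, ∃ C > 0, ∀ v, zerothCoeff γ k v ≤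
      wgt 1 (k - 1) v * wgt 1 (γ / 2) v * (C - c * (1 + ‖v‖ ^ 2)) := by
  have hk0 : 0 < k := by linarith
  have hI := integral_radG_pos (γ := γ) (by linarith)
  obtain ⟨D, hD0, hD⟩ := exists_integral_norm_rpow_mul_le h1 h2
  have hκ : 0 < 2 * k - γ - 3 := by linarith
  refine ⟨(2 * k - γ - 3) * (2 ^ (γ / 2) * ∫ w, radG γ w), by positivity,
    (2 * k + 2 * k ^ 2) * D, by positivity, fun v => ?_⟩
  have hN := kerBdd_norm_rpow (γ := γ) (β := γ) le_rfl (by linarith)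
  have hZ : HasInt (fun w => (1 / 2 * (∑ i, ∑ j, aker γ (v - w) i j * wgtDD k i j v)
      + (∑ i, bker γ (v - w) i * wgtD k i v)
      - 1 / 2 * (-2 * (γ + 3) * ‖v - w‖ ^ γ * wgt 1 k v)) * gaussM w) (zerothCoeff γ k v) := by
    have ha := (HasInt.sum fun i => HasInt.sum fun j =>
      (hasInt_gconv h1 (kerBdd_aker h1 h2 i j) v).const_mul (wgtDD k i j v)).const_mul (1 / 2)
    have hb := HasInt.sum fun i =>
      (hasInt_gconv h1 (kerBdd_bker h2 i) v).const_mul (wgtD k i v)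
    have hc := (hasInt_gconv h1 (kerBdd_cker h1 h2) v).const_mul (-(1 / 2) * wgt 1 k v)
    convert! ((ha.add hb).add hc).congr (g := fun w =>
      (1 / 2 * (∑ i, ∑ j, aker γ (v - w) i j * wgtDD k i j v)
      + (∑ i, bker γ (v - w) i * wgtD k i v)
      - 1 / 2 * (-2 * (γ + 3) * ‖v - w‖ ^ γ * wgt 1 k v)) * gaussM w) (fun w => ?_) using 1
    · rw [zerothCoeff, cbar_eq_gconv]
      simp only [abar, bbar, gconv, Fin.sum_univ_three]
      ring
    · simp only [Fin.sum_univ_three]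
      ring
  have hJ : HasInt (fun w => ‖v - w‖ ^ γ * gaussM w) (∫ w, ‖v - w‖ ^ γ * gaussM w) :=
    ⟨hN.integrable_mul h1 dec_gaussM v, rfl⟩
  have hL : HasInt (fun w => ‖v - w‖ ^ γ * ((1 + ‖w‖ ^ 2) * gaussM w))
      (∫ w, ‖v - w‖ ^ γ * ((1 + ‖w‖ ^ 2) * gaussM w)) :=
    ⟨hN.integrable_mul h1 dec_sq_mul_gaussM v, rfl⟩
  have hU := ((hJ.const_mul (-(2 * k - γ - 3) * (1 + ‖v‖ ^ 2))).add
    (hL.const_mul (2 * k + 2 * k ^ 2))).const_mul (wgt 1 (k - 1) v)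
  have hle := integral_mono_ae hZ.1 hU.1 (by
    filter_upwards [ae_sub_ne_zero v] with w hw
    refine le_trans (mul_le_mul_of_nonneg_right (zerothCoeff_integrand_le hk0 hw)
      (gaussM_nonneg w)) (le_of_eq ?_)
    ring)
  rw [hZ.2, hU.2] at hle
  refine hle.trans ?_
  rw [mul_assoc (wgt 1 (k - 1) v)]
  refine mul_le_mul_of_nonneg_left ?_ (wgt_pos one_pos _ _).le
  have h3 := mul_le_mul_of_nonneg_left (le_integral_norm_rpow h1 h2 v)
    (show 0 ≤ (2 * k - γ - 3) * (1 + ‖v‖ ^ 2) by positivity)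
  have h4 := mul_le_mul_of_nonneg_left (hD v) (show 0 ≤ 2 * k + 2 * k ^ 2 by positivity)
  linarith

/-- Product of a temperate function and a Schwartz function. -/
def tmul (g : V3 → ℝ) (F : SchwartzMap V3 ℝ) : SchwartzMap V3 ℝ := SchwartzMap.smulLeftCLM ℝ g F

lemma coe_tmul {g : V3 → ℝ} (hg : g.HasTemperateGrowth) (F : SchwartzMap V3 ℝ) :
    ⇑(tmul g F) = fun v => g v * F v := by
  ext v; simp [tmul, SchwartzMap.smulLeftCLM_apply_apply hg]

lemma integrable_mul_schwartz {g : V3 → ℝ} (hg : g.HasTemperateGrowth) (F : SchwartzMap V3 ℝ) :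
    Integrable (fun v => g v * F v) := by
  rw [← coe_tmul hg]; exact SchwartzMap.integrable _

lemma dec_mul_schwartz {g : V3 → ℝ} (hg : g.HasTemperateGrowth) (F : SchwartzMap V3 ℝ) :
    Dec (fun v => g v * F v) := by
  rw [← coe_tmul hg]; exact SchwartzMap.dec _

lemma pd_tmul {g : V3 → ℝ} (hg : g.HasTemperateGrowth) (F : SchwartzMap V3 ℝ) (j : Fin 3) (v : V3) :
    pd j (tmul g F) v = pd j g v * F v + g v * pd j F v := by
  rw [coe_tmul hg]
  exact pd_mul j hg.differentiable.differentiableAt F.differentiableAt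

/-- Partial derivatives of Schwartz functions as Schwartz functions. -/
def schwartzPd (j : Fin 3) (F : SchwartzMap V3 ℝ) : SchwartzMap V3 ℝ :=
  LineDeriv.lineDerivOp (EuclideanSpace.single j (1 : ℝ) : V3) F

lemma coe_schwartzPd (j : Fin 3) (F : SchwartzMap V3 ℝ) : ⇑(schwartzPd j F) = pd j F := rfl

lemma hasTemperateGrowth_wgtD (k : ℝ) (i : Fin 3) : (wgtD k i).HasTemperateGrowth :=
  ((Function.HasTemperateGrowth.const (2 * k)).mul (hasTemperateGrowth_coord i)).mul
    (hasTemperateGrowth_wgt one_pos (k - 1))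

lemma pd_wgt_eq_wgtD (k : ℝ) (i : Fin 3) (v : V3) : pd i (wgt 1 k) v = wgtD k i v :=
  pd_wgt one_pos k i v

lemma pd_wgtD (k : ℝ) (i j : Fin 3) (v : V3) : pd j (wgtD k i) v = wgtDD k i j v := by
  have h1 := differentiable_coord i
  have h2 := differentiable_wgt one_pos (k - 1)
  have e : wgtD k i = fun z => (2 * k) * (z i * wgt 1 (k - 1) z) := by
    funext z; unfold wgtD; ring
  rw [e, pd_const_mul j _ (h1.fun_mul h2).differentiableAt, pd_mul j h1.differentiableAt
    h2.differentiableAt, pd_coord, pd_wgt one_pos, wgtDD, show k - 1 - 1 = k - 2 by ring]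
  ring

lemma abar_symm (γ : ℝ) (v : V3) (i j : Fin 3) : abar γ v i j = abar γ v j i := by
  simp only [abar, aker_symm γ _ i j]

/-- The weighted energy identity. -/
lemma energy_identity {γ : ℝ} (h1 : -3 < γ) (h2 : γ < -2) (k : ℝ) (f : SchwartzMap V3 ℝ) :
    HasInt (fun v => B0op γ f v * f v * wgt 1 k v
      + (∑ i, ∑ j, abar γ v i j * pd i f v * pd j f v) * wgt 1 k v
      - f v ^ 2 * zerothCoeff γ k v) 0 := by
  have hf := f.hasTemperateGrowth
  have hn := hasTemperateGrowth_wgt one_pos k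
  have hfn := hf.mul hn
  have hfD := fun i => hf.mul (hasTemperateGrowth_wgtD k i)
  have hP : ∀ i, HasInt (fun v => (∑ j, abar γ v i j * pd j (tmul (⇑f * wgt 1 k) (schwartzPd i f)) v)
      + bbar γ v i * tmul (⇑f * wgt 1 k) (schwartzPd i f) v) 0 := fun i => weak_div_abar h1 h2 i _
  have hQ : ∀ i, HasInt (fun v => (∑ j, abar γ v i j * pd j (tmul (⇑f * wgtD k i) f) v)
      + bbar γ v i * tmul (⇑f * wgtD k i) f v) 0 := fun i => weak_div_abar h1 h2 i _
  have hT : HasInt (fun v => (∑ j, bbar γ v j * pd j (tmul (⇑f * wgt 1 k) f) v)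
      + cbar γ v * tmul (⇑f * wgt 1 k) f v) 0 := weak_div_bbar h1 h2 _
  have key := ((HasInt.sum hP).add ((HasInt.sum hQ).const_mul (-(1 / 2)))).add
    (hT.const_mul (-(1 / 2)))
  simp only [Finset.sum_const_zero, mul_zero, add_zero] at key
  refine key.congr fun v => ?_
  have d1 : ∀ j, pd j (⇑f * wgt 1 k) v = pd j f v * wgt 1 k v + f v * wgtD k j v := fun j => by
    rw [← pd_wgt_eq_wgtD]
    exact pd_mul j f.differentiableAt (differentiable_wgt one_pos k).differentiableAt
  have d2 : ∀ i j, pd j (⇑f * wgtD k i) v = pd j f v * wgtD k i v + f v * wgtDD k i j v :=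
    fun i j => by
      rw [← pd_wgtD]
      exact pd_mul j f.differentiableAt (hasTemperateGrowth_wgtD k i).differentiable.differentiableAt
  simp only [pd_tmul hfn, pd_tmul (hfD _), d1, d2]
  simp only [coe_tmul hfn, coe_tmul (hfD _), coe_schwartzPd, Pi.mul_apply, B0op, zerothCoeff,
    Fin.sum_univ_three, abar_symm γ v 1 0, abar_symm γ v 2 0, abar_symm γ v 2 1]
  ring

lemma integrable_B0op_mul {γ : ℝ} (h1 : -3 < γ) (h2 : γ < -2) (k : ℝ) (f : SchwartzMap V3 ℝ) :
    Integrable (fun v => B0op γ f v * f v * wgt 1 k v) := by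
  have hfn := f.hasTemperateGrowth.mul (hasTemperateGrowth_wgt one_pos k)
  have ha := integrable_finsetSum Finset.univ fun i _ => integrable_finsetSum Finset.univ fun j _ =>
    (kerBdd_aker h1 h2 i j).integrable_gconv_mul h1 (dec_mul_schwartz hfn
      (schwartzPd i (schwartzPd j f)))
  have hc := (kerBdd_cker h1 h2).integrable_gconv_mul h1 (dec_mul_schwartz hfn f)
  convert! ha.sub hc using 2 with v
  rw [B0op, cbar_eq_gconv]
  simp only [Fin.sum_univ_three, coe_schwartzPd, Pi.mul_apply, Pi.sub_apply, abar, gconv]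
  ring

/-- The anisotropic quadratic form `|x|² + |v × x|²`. -/
def anisoForm (v x : V3) : ℝ := ‖x‖ ^ 2 + crossq v x

lemma anisoForm_nonneg (v x : V3) : 0 ≤ anisoForm v x :=
  add_nonneg (sq_nonneg _) (crossq_nonneg v x)

lemma anisoForm_self (v : V3) : anisoForm v v = ‖v‖ ^ 2 := by
  simp only [anisoForm, crossq]; ring

lemma anisoForm_smul (v : V3) (a : ℝ) (x : V3) : anisoForm v (a • x) = a ^ 2 * anisoForm v x := by
  simp only [anisoForm, crossq, norm_sq_three, PiLp.smul_apply, smul_eq_mul]; ring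

lemma anisoForm_add_le (v x y : V3) :
    anisoForm v (x + y) ≤ 2 * anisoForm v x + 2 * anisoForm v y := by
  have h := anisoForm_nonneg v (x - y)
  simp only [anisoForm, crossq, norm_sq_three, PiLp.add_apply, PiLp.sub_apply] at h ⊢
  linarith

lemma jap_rpow (p : ℝ) (v : V3) : jap v ^ p = wgt 1 (p / 2) v := by
  rw [jap, Real.sqrt_eq_rpow, ← Real.rpow_mul (by positivity), wgt]
  congr 1; ring

lemma jap_sq (v : V3) : jap v ^ 2 = 1 + ‖v‖ ^ 2 := Real.sq_sqrt (by positivity)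

lemma norm_anisoGrad_sq (f : V3 → ℝ) (v : V3) :
    ‖anisoGrad f v‖ ^ 2 = anisoForm v (gradient f v) := by
  unfold anisoGrad
  set x := gradient f v
  have hJ := jap_sq v
  by_cases hv : v = 0
  · subst hv
    have h1 : jap 0 = 1 := by simp [jap]
    simp [Pv, anisoForm, crossq, h1]
  have hr : ‖v‖ ^ 2 ≠ 0 := by simpa using hv
  have ht : (∑ i, x i * v i) / ‖v‖ ^ 2 * ‖v‖ ^ 2 = ∑ i, x i * v i := div_mul_cancel₀ _ hr
  unfold Pv anisoForm crossq
  set t := (∑ i, x i * v i) / ‖v‖ ^ 2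
  simp only [norm_sq_three, PiLp.add_apply, PiLp.sub_apply, PiLp.smul_apply, smul_eq_mul,
    Fin.sum_univ_three] at ht hJ ⊢
  linear_combination (x 0 ^ 2 + x 1 ^ 2 + x 2 ^ 2 - 2 * t * (x 0 * v 0 + x 1 * v 1 + x 2 * v 2)
    + t ^ 2 * (v 0 ^ 2 + v 1 ^ 2 + v 2 ^ 2)) * hJ + (2 * t - 2 * jap v * t
    + (t * (v 0 ^ 2 + v 1 ^ 2 + v 2 ^ 2) - (x 0 * v 0 + x 1 * v 1 + x 2 * v 2))) * ht

lemma gradient_apply_eq_pd (f : V3 → ℝ) (v : V3) (i : Fin 3) : gradient f v i = pd i f v := by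
  have h := inner_gradient_left (f := f) (x := v) (y := EuclideanSpace.single i (1 : ℝ))
  rw [pd, ← h, EuclideanSpace.inner_single_right]
  simp

lemma integrable_weighted_anisoForm (γ k : ℝ) (f : SchwartzMap V3 ℝ) :
    Integrable (fun v => wgt 1 (γ / 2) v * anisoForm v (gradient f v) * wgt 1 k v) := by
  have hW := (hasTemperateGrowth_wgt one_pos (γ / 2)).mul (hasTemperateGrowth_wgt one_pos k)
  have hx := hasTemperateGrowth_coord
  have hp := fun i => (schwartzPd i f).hasTemperateGrowth
  have hS : Function.HasTemperateGrowth (fun v : V3 => ∑ j, v j * schwartzPd j f v) :=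
    Function.HasTemperateGrowth.sum fun j _ => (hx j).mul (hp j)
  have hG := fun i => hW.mul (((hasTemperateGrowth_wgt one_pos 1).mul (hp i)).sub ((hx i).mul hS))
  have := integrable_finsetSum Finset.univ fun i _ =>
    integrable_mul_schwartz (hG i) (schwartzPd i f)
  convert! this using 2 with v
  simp only [anisoForm, crossq, norm_sq_three (gradient _ _), gradient_apply_eq_pd,
    Fin.sum_univ_three, coe_schwartzPd, Pi.mul_apply, Pi.sub_apply]
  rw [show wgt 1 1 v = 1 + ‖v‖ ^ 2 by simp [wgt], norm_sq_three]
  ring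

lemma wgt_half_sq (p : ℝ) (v : V3) : wgt 1 (p / 2) v ^ 2 = wgt 1 p v := by
  rw [wgt, wgt, ← Real.rpow_mul_natCast (by positivity)]
  congr 1; push_cast; ring

lemma anisoForm_gradient_wgt_mul_le (k : ℝ) (f : SchwartzMap V3 ℝ) (v : V3) :
    anisoForm v (gradient (fun w => wgt 1 (k / 2) w * f w) v) ≤
      2 * (anisoForm v (gradient f v) * wgt 1 k v) + 2 * k ^ 2 * (f v ^ 2 * wgt 1 k v) := by
  have e : gradient (fun w => wgt 1 (k / 2) w * f w) v =
      wgt 1 (k / 2) v • gradient f v + (k * wgt 1 (k / 2 - 1) v * f v) • v := by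
    ext i
    rw [gradient_apply_eq_pd, pd_mul i (differentiable_wgt one_pos _).differentiableAt
      f.differentiableAt, pd_wgt one_pos]
    simp only [PiLp.add_apply, PiLp.smul_apply, smul_eq_mul, gradient_apply_eq_pd]
    ring
  rw [e]
  refine (anisoForm_add_le _ _ _).trans ?_
  rw [anisoForm_smul, anisoForm_smul, anisoForm_self]
  have h1 : wgt 1 (k / 2 - 1) v ^ 2 * ‖v‖ ^ 2 ≤ wgt 1 k v := by
    rw [← wgt_half_sq k, wgt_add_one one_pos (k / 2), mul_pow]
    exact mul_le_mul_of_nonneg_left (by nlinarith [sq_nonneg ‖v‖]) (sq_nonneg _)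
  have h2 := mul_le_mul_of_nonneg_left h1 (show 0 ≤ 2 * k ^ 2 * f v ^ 2 by positivity)
  rw [wgt_half_sq]
  nlinarith

lemma zerothCoeff_sub_cutoff_le {γ k c C : ℝ} (hγ : γ ≤ 0) (hc : 0 < c) (hC : 0 < C) {χ : V3 → ℝ}
    (hχ01 : ∀ v, χ v ∈ Set.Icc (0 : ℝ) 1) (hχ1 : ∀ v : V3, ‖v‖ ≤ 1 → χ v = 1) (v : V3)
    (hZ : zerothCoeff γ k v ≤ wgt 1 (k - 1) v * wgt 1 (γ / 2) v * (C - c * (1 + ‖v‖ ^ 2))) :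
    zerothCoeff γ k v - (C + c / 2) * χ ((max 1 (2 * C / c))⁻¹ • v) * wgt 1 k v ≤
      -(c / 2) * (wgt 1 (γ / 2) v * wgt 1 k v) := by
  set R := max 1 (2 * C / c)
  have hR1 : 1 ≤ R := le_max_left _ _
  have hR2 : 2 * C ≤ R * c := (div_le_iff₀ hc).1 (le_max_right _ _)
  have hu := wgt_pos one_pos (k - 1) v
  have hg := wgt_pos one_pos (γ / 2) v
  have hg1 := wgt_one_le_one (p := γ / 2) (by linarith) v
  have e := wgt_add_one one_pos k v
  have hW := wgt_pos one_pos k v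
  rcases le_or_gt ‖v‖ R with h | h
  · rw [hχ1 _ (by
      rw [norm_smul, norm_inv, Real.norm_of_nonneg (by positivity), inv_mul_le_iff₀ (by positivity)]
      linarith)]
    have h1 : wgt 1 (k - 1) v * wgt 1 (γ / 2) v * C ≤ wgt 1 k v * C := by
      refine mul_le_mul_of_nonneg_right ?_ hC.le
      rw [e]
      exact mul_le_mul_of_nonneg_left (by nlinarith [sq_nonneg ‖v‖]) hu.le
    have h2 : wgt 1 (γ / 2) v * wgt 1 k v * c ≥ 0 := by positivity
    have h3 : wgt 1 (k - 1) v * wgt 1 (γ / 2) v * (C - c * (1 + ‖v‖ ^ 2)) =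
      wgt 1 (k - 1) v * wgt 1 (γ / 2) v * C - wgt 1 (γ / 2) v * wgt 1 k v * c := by rw [e]; ring
    have h4 : 0 ≤ wgt 1 k v * c := by positivity
    linarith
  · have h1 : 0 ≤ (C + c / 2) * χ (R⁻¹ • v) * wgt 1 k v :=
      mul_nonneg (mul_nonneg (by positivity) (hχ01 _).1) hW.le
    have h2 : C - c * (1 + ‖v‖ ^ 2) ≤ -(c / 2) * (1 + ‖v‖ ^ 2) := by
      nlinarith [mul_le_mul_of_nonneg_left (show R ≤ ‖v‖ ^ 2 by nlinarith) hc.le]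
    have h3 := mul_le_mul_of_nonneg_left h2 (mul_pos hu hg).le
    have h4 : wgt 1 (k - 1) v * wgt 1 (γ / 2) v * (-(c / 2) * (1 + ‖v‖ ^ 2)) =
      -(c / 2) * (wgt 1 (γ / 2) v * wgt 1 k v) := by rw [e]; ring
    linarith

/-- Lemma 2.3 (weak dissipativity of B = B₀ − Mχ_R in L²(⟨v⟩^k), for k > (γ+3)/2). -/
theorem stmt11 (γ k : ℝ) (hγ : γ ∈ Set.Ioo (-3 : ℝ) (-2)) (hk : (γ + 3) / 2 < k)
    (χ : V3 → ℝ) (hχsm : ContDiff ℝ (⊤ : ℕ∞) χ) (hχ01 : ∀ v, χ v ∈ Set.Icc (0 : ℝ) 1)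
    (hχ1 : ∀ v : V3, ‖v‖ ≤ 1 → χ v = 1) (hχ0 : ∀ v : V3, 2 < ‖v‖ → χ v = 0) :
    ∃ M > (0 : ℝ), ∃ R > (0 : ℝ), ∃ C > (0 : ℝ), ∀ f : SchwartzMap V3 ℝ,
      (∫ v : V3, (B0op γ (⇑f) v - M * χ (R⁻¹ • v) * f v) * f v * (jap v ^ k) ^ 2)
        ≤ -C * ((∫ v : V3, jap v ^ γ * ‖anisoGrad (⇑f) v‖ ^ 2 * (jap v ^ k) ^ 2)
            + (∫ v : V3, jap v ^ γ * ‖anisoGrad (fun w => jap w ^ k * f w) v‖ ^ 2)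
            + (∫ v : V3, jap v ^ γ * f v ^ 2 * (jap v ^ k) ^ 2)) := by
  obtain ⟨h1, h2⟩ := hγ
  obtain ⟨c₁, hc₁, hA⟩ := abar_coercive h1 h2
  obtain ⟨c, hc, C, hC, hZ⟩ := exists_zerothCoeff_le h1 h2 hk
  set R := max 1 (2 * C / c) with hR
  have hR0 : 0 < R := lt_of_lt_of_le one_pos (le_max_left _ _)
  set K := min (c₁ / 3) (c / 2 / (1 + 2 * k ^ 2)) with hK
  have hK1 : K * 3 ≤ c₁ := (le_div_iff₀ (by norm_num)).1 (min_le_left _ _)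
  have hK2 : K * (1 + 2 * k ^ 2) ≤ c / 2 := (le_div_iff₀ (by positivity)).1 (min_le_right _ _)
  have hK0 : 0 < K := by positivity
  refine ⟨C + c / 2, by positivity, R, hR0, K, hK0, fun f => ?_⟩
  simp only [norm_anisoGrad_sq, jap_rpow, wgt_half_sq]
  have hff := integrable_mul_schwartz (f.hasTemperateGrowth.mul (hasTemperateGrowth_wgt one_pos k)) f
  have hD := integrable_weighted_anisoForm γ k f
  have hH : Integrable (fun v => wgt 1 (γ / 2) v * f v ^ 2 * wgt 1 k v) := by
    have := integrable_mul_schwartz ((hasTemperateGrowth_wgt one_pos (γ / 2)).mul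
      (f.hasTemperateGrowth.mul (hasTemperateGrowth_wgt one_pos k))) f
    convert! this using 2 with v
    simp only [Pi.mul_apply]; ring
  have hX : Integrable (fun v =>
      (B0op γ f v - (C + c / 2) * χ (R⁻¹ • v) * f v) * f v * wgt 1 k v) := by
    have hχ : Integrable (fun v => χ (R⁻¹ • v) * ((⇑f * wgt 1 k) v * f v)) :=
      hff.bdd_mul (c := 1) (hχsm.continuous.comp (by fun_prop)).aestronglyMeasurable
        (Eventually.of_forall fun v => by
          rw [Real.norm_of_nonneg (hχ01 _).1]; exact (hχ01 _).2)
    convert! (integrable_B0op_mul h1 h2 k f).sub (hχ.const_mul (C + c / 2)) using 2 with v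
    simp only [Pi.mul_apply, Pi.sub_apply]; ring
  obtain ⟨hΔ, hΔ0⟩ := energy_identity h1 h2 k f
  have hE : ∫ v, wgt 1 (γ / 2) v * anisoForm v (gradient (fun w => wgt 1 (k / 2) w * f w) v) ≤
      2 * (∫ v, wgt 1 (γ / 2) v * anisoForm v (gradient f v) * wgt 1 k v)
        + 2 * k ^ 2 * ∫ v, wgt 1 (γ / 2) v * f v ^ 2 * wgt 1 k v := by
    rw [← integral_const_mul, ← integral_const_mul,
      ← integral_add (hD.const_mul _) (hH.const_mul _)]
    refine integral_mono_of_nonneg (Eventually.of_forall fun v =>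
      mul_nonneg (wgt_pos one_pos _ _).le (anisoForm_nonneg _ _))
      ((hD.const_mul _).add (hH.const_mul _)) (Eventually.of_forall fun v => ?_)
    refine (mul_le_mul_of_nonneg_left (anisoForm_gradient_wgt_mul_le k f v)
      (wgt_pos one_pos _ _).le).trans (le_of_eq ?_)
    ring
  have hL : ∫ v, (B0op γ f v - (C + c / 2) * χ (R⁻¹ • v) * f v) * f v * wgt 1 k v ≤
      -c₁ * (∫ v, wgt 1 (γ / 2) v * anisoForm v (gradient f v) * wgt 1 k v)
        + -(c / 2) * ∫ v, wgt 1 (γ / 2) v * f v ^ 2 * wgt 1 k v := by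
    rw [← sub_zero (∫ v, (B0op γ f v - (C + c / 2) * χ (R⁻¹ • v) * f v) * f v * wgt 1 k v),
      ← hΔ0, ← integral_sub hX hΔ, ← integral_const_mul, ← integral_const_mul,
      ← integral_add (hD.const_mul _) (hH.const_mul _)]
    refine integral_mono (hX.sub hΔ) ((hD.const_mul _).add (hH.const_mul _)) fun v => ?_
    have a1 := mul_le_mul_of_nonneg_right (hA v (gradient f v)) (wgt_pos one_pos k v).le
    have a2 := mul_le_mul_of_nonneg_left (zerothCoeff_sub_cutoff_le (by linarith) hc hC hχ01 hχ1 v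
      (hZ v)) (sq_nonneg (f v))
    rw [← hR] at a2
    simp only [gradient_apply_eq_pd] at a1
    beta_reduce
    rw [anisoForm]
    linarith
  have hD0 : 0 ≤ ∫ v, wgt 1 (γ / 2) v * anisoForm v (gradient f v) * wgt 1 k v :=
    integral_nonneg fun v => mul_nonneg (mul_nonneg (wgt_pos one_pos _ _).le
      (anisoForm_nonneg _ _)) (wgt_pos one_pos _ _).le
  have hH0 : 0 ≤ ∫ v, wgt 1 (γ / 2) v * f v ^ 2 * wgt 1 k v :=
    integral_nonneg fun v => mul_nonneg (mul_nonneg (wgt_pos one_pos _ _).le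
      (sq_nonneg _)) (wgt_pos one_pos _ _).le
  refine hL.trans ?_
  have b1 := mul_le_mul_of_nonneg_left hE hK0.le
  have b2 := mul_le_mul_of_nonneg_right hK1 hD0
  have b3 := mul_le_mul_of_nonneg_right hK2 hH0
  linarith
end
end

section
/- Let −3 < α < 0 and θ > 3. Then there exists a constant C > 0 such that for all v ∈ ℝ³ one has ∫_{ℝ³} |v−v_*|^α ⟨v_*⟩^{−θ} dv_* ≤ C ⟨v⟩^α. -/
noncomputable section

open MeasureTheory Real Filter

lemma one_le_jap (v : V3) : 1 ≤ jap v :=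
  Real.one_le_sqrt.2 (by nlinarith [sq_nonneg ‖v‖])

/-- The Japanese bracket is 1-Lipschitz. -/
lemma jap_le_jap_add_norm_sub (v w : V3) : jap v ≤ jap w + ‖v - w‖ := by
  have hw : jap w ^ 2 = 1 + ‖w‖ ^ 2 := Real.sq_sqrt (by positivity)
  have hle : ‖w‖ ≤ jap w := Real.le_sqrt_of_sq_le (by linarith)
  have htri : ‖v‖ ≤ ‖w‖ + ‖v - w‖ := by
    simpa using norm_add_le w (v - w)
  have hz := norm_nonneg (v - w)
  refine Real.sqrt_le_iff.2 ⟨by linarith [one_le_jap w], ?_⟩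
  nlinarith [mul_le_mul_of_nonneg_right hle hz, norm_nonneg v, norm_nonneg w]

lemma integrable_jap_rpow_neg {θ : ℝ} (hθ : 3 < θ) :
    Integrable (fun w : V3 => jap w ^ (-θ)) := by
  have h := integrable_rpow_neg_one_add_norm_sq (E := V3) (μ := volume) (r := θ) (by simpa using hθ)
  refine h.congr (Eventually.of_forall fun w => ?_)
  exact Real.rpow_div_two_eq_sqrt _ (by positivity)

lemma integrableOn_norm_rpow_ball {α : ℝ} (hα : -3 < α) :
    IntegrableOn (fun z : V3 => ‖z‖ ^ α) (Metric.ball 0 1) := by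
  rw [integrableOn_fun_norm_addHaar volume (f := fun y : ℝ => y ^ α)]
  have h : IntegrableOn (fun y : ℝ => y ^ (2 + α)) (Set.Ioo 0 1) :=
    (intervalIntegral.integrableOn_Ioo_rpow_iff one_pos).2 (by linarith)
  refine h.congr_fun (fun y hy => ?_) measurableSet_Ioo
  simp [Real.rpow_add hy.1]

/-- A pointwise majorant of the convolution kernel, whose integral over `w` is finite and
independent of `v`. -/
lemma norm_sub_rpow_mul_jap_rpow_le {α θ : ℝ} (hα : α ∈ Set.Ioo (-3 : ℝ) 0) (hθ : 3 < θ)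
    (v w : V3) :
    ‖v - w‖ ^ α * jap w ^ (-θ) ≤ 2 ^ (θ - α) * jap v ^ α *
      (jap w ^ (-θ) + (Metric.ball (0 : V3) 1).indicator (fun z => ‖z‖ ^ α) (v - w)
        + (1 + ‖v - w‖) ^ (-θ)) := by
  obtain ⟨hα₁, hα₂⟩ := hα
  have hlip := jap_le_jap_add_norm_sub v w
  have hv := one_le_jap v
  have hw := one_le_jap w
  set J := jap v
  set K := jap w
  set z := v - w
  have hJ : 0 < J := by linarith
  have hK : 0 < K := by linarith
  have hz := norm_nonneg z
  have hind : 0 ≤ (Metric.ball (0 : V3) 1).indicator (fun z => ‖z‖ ^ α) z :=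
    Set.indicator_nonneg (fun _ _ => by positivity) _
  have hKθ : 0 ≤ K ^ (-θ) := by positivity
  have hzθ : 0 ≤ (1 + ‖z‖) ^ (-θ) := by positivity
  rcases le_total (J / 2) ‖z‖ with hfar | hnear
  · have h : ‖z‖ ^ α ≤ 2 ^ (θ - α) * J ^ α :=
      calc ‖z‖ ^ α ≤ (J / 2) ^ α :=
            Real.rpow_le_rpow_of_nonpos (by positivity) hfar hα₂.le
        _ = 2 ^ (-α) * J ^ α := by
            rw [Real.div_rpow hJ.le (by norm_num), Real.rpow_neg (by norm_num)]; field_simp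
        _ ≤ 2 ^ (θ - α) * J ^ α := by
            gcongr
            · norm_num
            · linarith
    calc ‖z‖ ^ α * K ^ (-θ) ≤ 2 ^ (θ - α) * J ^ α * K ^ (-θ) := by gcongr
      _ ≤ _ := by gcongr; linarith
  · have h : K ^ (-θ) ≤ 2 ^ θ * J ^ α * J ^ (-(θ + α)) :=
      calc K ^ (-θ) ≤ (J / 2) ^ (-θ) :=
            Real.rpow_le_rpow_of_nonpos (by positivity) (by linarith) (by linarith)
        _ = 2 ^ θ * J ^ (-θ) := by
            rw [Real.div_rpow hJ.le (by norm_num), Real.rpow_neg (by norm_num : (0 : ℝ) ≤ 2)]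
            field_simp
        _ = 2 ^ θ * J ^ α * J ^ (-(θ + α)) := by
            rw [mul_assoc, ← Real.rpow_add hJ]; congr 2; ring
    have h2 : (2 : ℝ) ^ (θ - α) = 2 ^ θ * 2 ^ (-α) := by
      rw [← Real.rpow_add (by norm_num), sub_eq_add_neg]
    suffices hs : ‖z‖ ^ α * J ^ (-(θ + α)) ≤
        2 ^ (-α) * ((Metric.ball (0 : V3) 1).indicator (fun z => ‖z‖ ^ α) z
          + (1 + ‖z‖) ^ (-θ)) by
      calc ‖z‖ ^ α * K ^ (-θ) ≤ ‖z‖ ^ α * (2 ^ θ * J ^ α * J ^ (-(θ + α))) := by gcongr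
        _ = 2 ^ θ * J ^ α * (‖z‖ ^ α * J ^ (-(θ + α))) := by ring
        _ ≤ 2 ^ θ * J ^ α * (2 ^ (-α) *
            ((Metric.ball (0 : V3) 1).indicator (fun z => ‖z‖ ^ α) z
              + (1 + ‖z‖) ^ (-θ))) := by gcongr
        _ = 2 ^ (θ - α) * J ^ α * ((Metric.ball (0 : V3) 1).indicator (fun z => ‖z‖ ^ α) z
              + (1 + ‖z‖) ^ (-θ)) := by rw [h2]; ring
        _ ≤ _ := by gcongr; linarith
    rcases lt_or_ge ‖z‖ 1 with hz₁ | hz₁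
    · rw [Set.indicator_of_mem (by simpa using hz₁)]
      have h₁ : J ^ (-(θ + α)) ≤ 1 :=
        Real.rpow_le_one_of_one_le_of_nonpos hv (by linarith)
      have h₂ : (1 : ℝ) ≤ 2 ^ (-α) := Real.one_le_rpow (by norm_num) (by linarith)
      calc ‖z‖ ^ α * J ^ (-(θ + α)) ≤ ‖z‖ ^ α * 1 := by gcongr
        _ = 1 * ‖z‖ ^ α := by ring
        _ ≤ _ := by gcongr; linarith
    · calc ‖z‖ ^ α * J ^ (-(θ + α))
          ≤ ((1 + ‖z‖) / 2) ^ α * (1 + ‖z‖) ^ (-(θ + α)) := by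
            apply mul_le_mul _ _ (by positivity) (by positivity)
            · exact Real.rpow_le_rpow_of_nonpos (by positivity) (by linarith) hα₂.le
            · exact Real.rpow_le_rpow_of_nonpos (by positivity) (by linarith) (by linarith)
        _ = 2 ^ (-α) * ((1 + ‖z‖) ^ α * (1 + ‖z‖) ^ (-(θ + α))) := by
            rw [Real.div_rpow (by positivity) (by norm_num),
              Real.rpow_neg (by norm_num : (0 : ℝ) ≤ 2)]
            field_simp
        _ = 2 ^ (-α) * (1 + ‖z‖) ^ (-θ) := by
            rw [← Real.rpow_add (by positivity)]; congr 2; ring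
        _ ≤ _ := by gcongr; linarith

/-- Lemma 4.1: for −3 < α < 0 and θ > 3, ∫ |v−v*|^α ⟨v*⟩^{−θ} dv* ≤ C⟨v⟩^α. -/
theorem stmt14 (α θ : ℝ) (hα : α ∈ Set.Ioo (-3 : ℝ) 0) (hθ : 3 < θ) :
    ∃ C > (0 : ℝ), ∀ v : V3,
      (∫ w : V3, ‖v - w‖ ^ α * jap w ^ (-θ)) ≤ C * jap v ^ α := by
  have hjap := integrable_jap_rpow_neg hθ
  have hball := (integrable_indicator_iff Metric.isOpen_ball.measurableSet).2
    (integrableOn_norm_rpow_ball hα.1)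
  have htail := integrable_one_add_norm (E := V3) (μ := volume) (r := θ) (by simpa using hθ)
  set g : V3 → ℝ := (Metric.ball (0 : V3) 1).indicator fun z => ‖z‖ ^ α
  set A := ∫ w : V3, jap w ^ (-θ)
  set B := ∫ z, g z
  set D := ∫ z : V3, (1 + ‖z‖) ^ (-θ)
  have hA : 0 ≤ A := integral_nonneg fun w => Real.rpow_nonneg (Real.sqrt_nonneg _) _
  have hB : 0 ≤ B := integral_nonneg fun z =>
    Set.indicator_nonneg (fun _ _ => by positivity) _
  have hD : 0 ≤ D := integral_nonneg fun z => by positivity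
  refine ⟨2 ^ (θ - α) * (A + B + D + 1), by positivity, fun v => ?_⟩
  have hball' := hball.comp_sub_left v
  have htail' := htail.comp_sub_left v
  have hsum : Integrable fun w => jap w ^ (-θ) + g (v - w) := hjap.add hball'
  calc ∫ w : V3, ‖v - w‖ ^ α * jap w ^ (-θ)
      ≤ ∫ w : V3, 2 ^ (θ - α) * jap v ^ α *
          (jap w ^ (-θ) + g (v - w) + (1 + ‖v - w‖) ^ (-θ)) :=
        integral_mono_of_nonneg
          (Eventually.of_forall fun w => mul_nonneg (by positivity)
            (Real.rpow_nonneg (Real.sqrt_nonneg _) _))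
          ((hsum.add htail').const_mul _)
          (Eventually.of_forall (norm_sub_rpow_mul_jap_rpow_le hα hθ v))
    _ = 2 ^ (θ - α) * jap v ^ α * (A + B + D) := by
        rw [integral_const_mul, integral_add hsum htail', integral_add hjap hball',
          integral_sub_left_eq_self g volume v,
          integral_sub_left_eq_self (fun z : V3 => (1 + ‖z‖) ^ (-θ)) volume v]
    _ ≤ 2 ^ (θ - α) * jap v ^ α * (A + B + D + 1) := by
        have := Real.rpow_nonneg (Real.sqrt_nonneg (1 + ‖v‖ ^ 2)) α
        exact mul_le_mul_of_nonneg_left (by linarith) (mul_nonneg (by positivity) this)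
    _ = 2 ^ (θ - α) * (A + B + D + 1) * jap v ^ α := by ring
end
end
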